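/- arXiv:2207.02839 — 9 statements merged into one kernel-verified Lean document; each statement's English description precedes it below -/
import Mathlib

section
/- A matrix-valued kernel Γ: ℝ^d × ℝ^d → ℝ^{m×m} is conditionally negative definite if and only if for every t > 0 the kernel exp*(−tΓ), i.e. the kernel with entries (x,y) ↦ exp(−t·γ_ij(x,y)), is a positive definite matrix-valued kernel. -/
open Matrix MeasureTheory Real Set
open scoped BigOperators

/-- A matrix-valued kernel `C : X × X → ℝ^{m×m}` is positive definite if it is symmetric
(`C_ij(x,y) = C_ji(y,x)`) and all quadratic forms `∑_p ∑_q a_pᵀ C(x_p, x_q) a_q` are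
nonnegative. -/
def IsPosDefKernel {X : Type*} {m : ℕ} (C : X → X → Matrix (Fin m) (Fin m) ℝ) : Prop :=
  (∀ x y i j, C x y i j = C y x j i) ∧
  ∀ (n : ℕ) (x : Fin n → X) (a : Fin n → Fin m → ℝ),
    0 ≤ ∑ p, ∑ q, a p ⬝ᵥ (C (x p) (x q)).mulVec (a q)

/-- A matrix-valued kernel `Γ : X × X → ℝ^{m×m}` is conditionally negative definite if it is
symmetric (`Γ_ij(x,y) = Γ_ji(y,x)`) and all quadratic forms `∑_p ∑_q a_pᵀ Γ(x_p, x_q) a_q`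
with `1_mᵀ ∑_p a_p = 0` are nonpositive. -/
def IsCondNegDefKernel {X : Type*} {m : ℕ} (Γ : X → X → Matrix (Fin m) (Fin m) ℝ) : Prop :=
  (∀ x y i j, Γ x y i j = Γ y x j i) ∧
  ∀ (n : ℕ) (x : Fin n → X) (a : Fin n → Fin m → ℝ),
    (∑ p, ∑ i, a p i) = 0 →
    ∑ p, ∑ q, a p ⬝ᵥ (Γ (x p) (x q)).mulVec (a q) ≤ 0

/-- A non-stationary pseudo cross-variogram: a conditionally negative definite matrix-valued
kernel vanishing on the diagonal of its diagonal components. -/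
def IsNSPseudoCrossVariogram {X : Type*} {m : ℕ}
    (Γ : X → X → Matrix (Fin m) (Fin m) ℝ) : Prop :=
  IsCondNegDefKernel Γ ∧ ∀ x i, Γ x x i i = 0

/-- A matrix-valued function is positive definite if the associated translation-invariant
kernel `(x, y) ↦ C (x - y)` is a positive definite kernel. -/
def IsPosDefFun {V : Type*} [AddCommGroup V] {m : ℕ}
    (C : V → Matrix (Fin m) (Fin m) ℝ) : Prop :=
  IsPosDefKernel (fun x y => C (x - y))

/-- A (stationary) pseudo cross-variogram: the kernel `(x,y) ↦ γ(x−y)` is conditionally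
negative definite and `γ_ii(0) = 0` for all `i`. -/
def IsPseudoCrossVariogram {V : Type*} [AddCommGroup V] {m : ℕ}
    (γ : V → Matrix (Fin m) (Fin m) ℝ) : Prop :=
  IsCondNegDefKernel (fun x y => γ (x - y)) ∧ ∀ i, γ 0 i i = 0

/-- Entrywise powers of a positive semidefinite matrix are positive semidefinite. -/
lemma Matrix.PosSemidef.map_pow {ι : Type*} [Fintype ι] {K : Matrix ι ι ℝ}
    (hK : K.PosSemidef) (n : ℕ) : (K.map (· ^ n)).PosSemidef := by
  classical
  induction n with
  | zero =>
    convert posSemidef_vecMulVec_self_star (1 : ι → ℝ) using 1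
    ext i j
    simp [vecMulVec_apply]
  | succ n ih =>
    have heq : K.map (· ^ (n + 1)) = K.map (· ^ n) ⊙ K := by
      ext i j
      simp [pow_succ]
    rw [heq]
    exact ih.hadamard hK

/-- The entrywise exponential of a positive semidefinite matrix has a nonnegative quadratic
form. -/
lemma Matrix.PosSemidef.sum_mul_exp_nonneg {ι : Type*} [Fintype ι] {K : Matrix ι ι ℝ}
    (hK : K.PosSemidef) (c : ι → ℝ) : 0 ≤ ∑ a, ∑ b, c a * c b * Real.exp (K a b) := by
  have hs : HasSum (fun n : ℕ => ∑ a, ∑ b, c a * c b * (K a b ^ n / n.factorial))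
      (∑ a, ∑ b, c a * c b * Real.exp (K a b)) := by
    refine hasSum_sum fun a _ => hasSum_sum fun b _ => HasSum.mul_left _ ?_
    rw [Real.exp_eq_exp_ℝ]
    exact NormedSpace.expSeries_div_hasSum_exp (K a b)
  refine hs.nonneg fun n => ?_
  have h := (hK.map_pow n).dotProduct_mulVec_nonneg c
  have heq : ∑ a, ∑ b, c a * c b * (K a b ^ n / n.factorial) =
      (star c ⬝ᵥ (K.map (· ^ n)).mulVec c) / n.factorial := by
    simp only [dotProduct, mulVec, Finset.mul_sum, Finset.sum_div]
    refine Finset.sum_congr rfl fun a _ => Finset.sum_congr rfl fun b _ => ?_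
    simp only [Pi.star_apply, star_trivial, map_apply]
    ring
  rw [heq]
  positivity

/-- For a symmetric matrix `G` that is conditionally negative definite, and a base point `o`,
the matrix `G a o + G o b - G a b - G o o` is positive semidefinite. -/
lemma posSemidef_of_condNegDef {ι : Type*} [Fintype ι] {G : Matrix ι ι ℝ}
    (hsymm : ∀ a b, G a b = G b a)
    (hG : ∀ c : ι → ℝ, ∑ a, c a = 0 → ∑ a, ∑ b, c a * c b * G a b ≤ 0) (o : ι) :
    (Matrix.of fun a b => G a o + G o b - G a b - G o o).PosSemidef := by
  classical
  refine Matrix.PosSemidef.of_dotProduct_mulVec_nonneg ?_ fun c => ?_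
  · ext a b
    simp only [conjTranspose_apply, of_apply, star_trivial]
    rw [hsymm b o, hsymm o a, hsymm b a]
    ring
  · have h := hG (fun a => c a - (∑ e, c e) * if a = o then 1 else 0) (by simp)
    have key : ∀ s : ℝ, ∑ a, ∑ b, (c a - s * if a = o then 1 else 0) *
        (c b - s * if b = o then 1 else 0) * G a b =
        ∑ a, ∑ b, c a * c b * G a b - s * ∑ a, c a * G a o - s * ∑ b, c b * G o b
          + s * s * G o o := by
      intro s
      have inner : ∀ a, ∑ b, (c a - s * if a = o then 1 else 0) *
          (c b - s * if b = o then 1 else 0) * G a b =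
          (c a - s * if a = o then 1 else 0) * (∑ b, c b * G a b - s * G a o) := by
        intro a
        simp [mul_assoc, sub_mul, Finset.sum_sub_distrib, ← Finset.mul_sum]
      simp only [inner]
      simp [sub_mul, mul_assoc, mul_sub, Finset.sum_sub_distrib, Finset.mul_sum]
      simp only [mul_left_comm]
      ring
    rw [key] at h
    have heq : star c ⬝ᵥ (of fun a b => G a o + G o b - G a b - G o o).mulVec c =
        -(∑ a, ∑ b, c a * c b * G a b - (∑ e, c e) * ∑ a, c a * G a o
          - (∑ e, c e) * ∑ b, c b * G o b + (∑ e, c e) * (∑ e, c e) * G o o) := by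
      rw [mul_comm (∑ e, c e) (∑ b, c b * G o b)]
      simp only [Finset.sum_mul, dotProduct, mulVec, Finset.mul_sum,
        ← Finset.sum_sub_distrib, ← Finset.sum_add_distrib, ← Finset.sum_neg_distrib]
      refine Finset.sum_congr rfl fun a _ => Finset.sum_congr rfl fun b _ => ?_
      simp only [Pi.star_apply, star_trivial, of_apply]
      ring
    rw [heq]
    linarith

/-- The scalar Schoenberg theorem on a finite index set, forward direction. -/
lemma sum_mul_exp_neg_nonneg_of_condNegDef {ι : Type*} [Fintype ι] {G : Matrix ι ι ℝ}
    (hsymm : ∀ a b, G a b = G b a)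
    (hG : ∀ c : ι → ℝ, ∑ a, c a = 0 → ∑ a, ∑ b, c a * c b * G a b ≤ 0)
    {t : ℝ} (ht : 0 ≤ t) (c : ι → ℝ) :
    0 ≤ ∑ a, ∑ b, c a * c b * Real.exp (-t * G a b) := by
  rcases isEmpty_or_nonempty ι with _ | ⟨⟨o⟩⟩
  · simp
  have h := ((posSemidef_of_condNegDef hsymm hG o).smul ht).sum_mul_exp_nonneg
    fun a => c a * Real.exp (-t * G a o)
  have heq : ∑ a, ∑ b, c a * c b * Real.exp (-t * G a b) =
      Real.exp (t * G o o) * ∑ a, ∑ b, (c a * Real.exp (-t * G a o)) *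
        (c b * Real.exp (-t * G b o)) *
        Real.exp ((t • of fun a b => G a o + G o b - G a b - G o o) a b) := by
    simp only [Finset.mul_sum]
    refine Finset.sum_congr rfl fun a _ => Finset.sum_congr rfl fun b _ => ?_
    have hexp : Real.exp (-t * G a b) = Real.exp (t * G o o) * Real.exp (-t * G a o) *
        Real.exp (-t * G b o) *
        Real.exp ((t • of fun a b => G a o + G o b - G a b - G o o) a b) := by
      rw [← Real.exp_add, ← Real.exp_add, ← Real.exp_add]
      simp only [Matrix.smul_apply, of_apply, smul_eq_mul, hsymm b o]
      ring_nf
    rw [hexp]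
    ring
  rw [heq]
  positivity

/-- The quadratic form of a matrix-valued kernel as a sum over pairs of indices. -/
lemma sum_dotProduct_mulVec_eq {ι κ : Type*} [Fintype ι] [Fintype κ]
    (M : ι → ι → Matrix κ κ ℝ) (a : ι → κ → ℝ) :
    ∑ p, ∑ q, a p ⬝ᵥ (M p q).mulVec (a q) =
      ∑ u : ι × κ, ∑ v : ι × κ, a u.1 u.2 * a v.1 v.2 * M u.1 v.1 u.2 v.2 := by
  simp only [Fintype.sum_prod_type, dotProduct, mulVec, Finset.mul_sum]
  refine Finset.sum_congr rfl fun p _ => ?_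
  rw [Finset.sum_comm]
  refine Finset.sum_congr rfl fun i _ => Finset.sum_congr rfl fun q _ =>
    Finset.sum_congr rfl fun j _ => ?_
  ring

/-- If all the entrywise exponentials `exp (-t G)` have nonnegative quadratic form, then `G` is
conditionally negative definite. -/
lemma condNegDef_of_sum_mul_exp_neg_nonneg {ι : Type*} [Fintype ι] {G : Matrix ι ι ℝ}
    {c : ι → ℝ} (hc : ∑ a, c a = 0)
    (h : ∀ t : ℝ, 0 < t → 0 ≤ ∑ a, ∑ b, c a * c b * Real.exp (-t * G a b)) :
    ∑ a, ∑ b, c a * c b * G a b ≤ 0 := by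
  set f : ℝ → ℝ := fun t => ∑ a, ∑ b, c a * c b * Real.exp (-t * G a b) with hf
  have hderiv : HasDerivAt f (-∑ a, ∑ b, c a * c b * G a b) 0 := by
    simp only [hf, ← Finset.sum_neg_distrib]
    refine HasDerivAt.fun_sum fun a _ => HasDerivAt.fun_sum fun b _ => ?_
    have := (((hasDerivAt_id (0 : ℝ)).neg.mul_const (G a b)).exp).const_mul (c a * c b)
    exact this.congr_deriv (by simp)
  have hf0 : f 0 = 0 := by
    simp [hf, ← Finset.mul_sum, hc]
  have : 0 ≤ -∑ a, ∑ b, c a * c b * G a b := by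
    refine ge_of_tendsto hderiv.tendsto_slope_zero_right ?_
    filter_upwards [self_mem_nhdsWithin] with t ht
    have ht' : 0 < t := ht
    simp only [zero_add, hf0, sub_zero, smul_eq_mul]
    exact mul_nonneg (inv_nonneg.2 ht'.le) (h t ht')
  linarith

/-- A matrix-valued kernel `Γ` is conditionally negative definite iff
`exp*(−tΓ)` is a positive definite matrix-valued kernel for every `t > 0`. -/
theorem schoenberg_matrix_valued {d m : ℕ}
    (Γ : (Fin d → ℝ) → (Fin d → ℝ) → Matrix (Fin m) (Fin m) ℝ) :
    IsCondNegDefKernel Γ ↔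
      ∀ t : ℝ, 0 < t →
        IsPosDefKernel (fun x y => Matrix.of fun i j => Real.exp (-t * Γ x y i j)) := by
  constructor
  · rintro ⟨hsymm, hΓ⟩ t ht
    refine ⟨fun x y i j => by simp [hsymm x y i j], fun n x a => ?_⟩
    rw [sum_dotProduct_mulVec_eq (fun p q => of fun i j => Real.exp (-t * Γ (x p) (x q) i j))]
    refine sum_mul_exp_neg_nonneg_of_condNegDef
      (G := of fun u v : Fin n × Fin m => Γ (x u.1) (x v.1) u.2 v.2)
      (fun u v => hsymm _ _ _ _) (fun c hc => ?_) ht.le fun u => a u.1 u.2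
    have h := hΓ n x (fun p i => c (p, i)) (by rwa [← Fintype.sum_prod_type])
    rwa [sum_dotProduct_mulVec_eq (fun p q => Γ (x p) (x q))] at h
  · intro h
    refine ⟨fun x y i j => ?_, fun n x a ha => ?_⟩
    · simpa using (h 1 one_pos).1 x y i j
    · rw [sum_dotProduct_mulVec_eq (fun p q => Γ (x p) (x q))]
      refine condNegDef_of_sum_mul_exp_neg_nonneg
        (G := of fun u v : Fin n × Fin m => Γ (x u.1) (x v.1) u.2 v.2)
        (by rwa [Fintype.sum_prod_type]) fun t ht => ?_
      have hq := (h t ht).2 n x a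
      rwa [sum_dotProduct_mulVec_eq
        (fun p q => of fun i j => Real.exp (-t * Γ (x p) (x q) i j))] at hq
end

section
/- Let Γ: ℝ^d × ℝ^d → ℝ^{m×m} be a conditionally negative definite matrix-valued kernel. Then there exist functions g_1,…,g_m: ℝ^d → ℝ and a positive definite matrix-valued kernel C such that γ_ij(x,y) = g_i(x) + g_j(y) − C_ij(x,y) for all x,y ∈ ℝ^d and i,j = 1,…,m. Conversely, any matrix-valued kernel Γ of the form γ_ij(x,y) = g_i(x) + g_j(y) − C_ij(x,y) with functions g_i: ℝ^d → ℝ and a positive definite matrix-valued kernel C is conditionally negative definite; if in addition γ_ii(x,x) = 0 for all x ∈ ℝ^d and i = 1,…,m, then Γ is a non-stationary pseudo cross-variogram. -/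
open Matrix MeasureTheory Real Set
open scoped BigOperators

/-- Kernels that differ by a sign and a term `g_i(x) + g_j(y)` have opposite quadratic forms at
coefficients of total sum zero. -/
theorem kernel_sum_eq_neg_of_eq_add_sub {X : Type*} {m : ℕ}
    {K L : X → X → Matrix (Fin m) (Fin m) ℝ} {g : Fin m → X → ℝ}
    (h : ∀ x y i j, K x y i j = g i x + g j y - L x y i j)
    {n : ℕ} (x : Fin n → X) (a : Fin n → Fin m → ℝ) (ha : ∑ p, ∑ i, a p i = 0) :
    ∑ p, ∑ q, a p ⬝ᵥ (K (x p) (x q)).mulVec (a q) =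
      -∑ p, ∑ q, a p ⬝ᵥ (L (x p) (x q)).mulVec (a q) := by
  have split_form (p q : Fin n) : a p ⬝ᵥ (K (x p) (x q)).mulVec (a q) =
      (∑ i, a p i * g i (x p)) * (∑ j, a q j) + (∑ i, a p i) * (∑ j, g j (x q) * a q j)
        - a p ⬝ᵥ (L (x p) (x q)).mulVec (a q) := by
    rw [Finset.sum_mul_sum, Finset.sum_mul_sum]
    simp only [dotProduct, Matrix.mulVec, h, Finset.mul_sum, ← Finset.sum_add_distrib,
      ← Finset.sum_sub_distrib]
    refine Finset.sum_congr rfl fun i _ => Finset.sum_congr rfl fun j _ => ?_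
    ring
  simp only [split_form, Finset.sum_add_distrib, Finset.sum_sub_distrib, ← Finset.mul_sum,
    ← Finset.sum_mul, ha]
  ring

/-- A symmetric kernel vanishing at a base point `(x₀, i₀)` is positive definite once its quadratic
forms are nonnegative at coefficients of total sum zero. -/
theorem IsPosDefKernel.of_sum_eq_zero {X : Type*} {m : ℕ}
    {C : X → X → Matrix (Fin m) (Fin m) ℝ} (hsymm : ∀ x y i j, C x y i j = C y x j i)
    (x₀ : X) (i₀ : Fin m) (hbase : ∀ x i, C x x₀ i i₀ = 0)
    (hC : ∀ (n : ℕ) (x : Fin n → X) (a : Fin n → Fin m → ℝ), ∑ p, ∑ i, a p i = 0 →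
      0 ≤ ∑ p, ∑ q, a p ⬝ᵥ (C (x p) (x q)).mulVec (a q)) :
    IsPosDefKernel C := by
  refine ⟨hsymm, fun n x a => ?_⟩
  have hbase' (y : X) (j : Fin m) : C x₀ y i₀ j = 0 := by rw [hsymm, hbase]
  have key := hC (n + 1) (Fin.cons x₀ x) (Fin.cons (Pi.single i₀ (-∑ p, ∑ i, a p i)) a)
    (by simp [Fin.sum_univ_succ])
  have hcol (y : X) (c : ℝ) : (C y x₀).mulVec (Pi.single i₀ c) = 0 := by
    ext i
    simp [hbase]
  have hrow (y : X) (v : Fin m → ℝ) : (C x₀ y).mulVec v i₀ = 0 := by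
    simp [Matrix.mulVec, dotProduct, hbase']
  simpa [Fin.sum_univ_succ, hcol, hrow] using key

/-- Structure theorem for conditionally negative definite matrix-valued kernels:
`Γ` is conditionally negative definite iff `γ_ij(x,y) = g_i(x) + g_j(y) − C_ij(x,y)` for
functions `g_i` and a positive definite kernel `C`; if moreover `γ_ii(x,x) = 0`, then `Γ` is a
non-stationary pseudo cross-variogram. -/
theorem cnd_kernel_structure {d m : ℕ} :
    (∀ Γ : (Fin d → ℝ) → (Fin d → ℝ) → Matrix (Fin m) (Fin m) ℝ,
      IsCondNegDefKernel Γ →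
      ∃ (g : Fin m → (Fin d → ℝ) → ℝ)
        (C : (Fin d → ℝ) → (Fin d → ℝ) → Matrix (Fin m) (Fin m) ℝ),
        IsPosDefKernel C ∧
        ∀ x y i j, Γ x y i j = g i x + g j y - C x y i j) ∧
    (∀ (Γ C : (Fin d → ℝ) → (Fin d → ℝ) → Matrix (Fin m) (Fin m) ℝ)
        (g : Fin m → (Fin d → ℝ) → ℝ),
        IsPosDefKernel C →
        (∀ x y i j, Γ x y i j = g i x + g j y - C x y i j) →
        IsCondNegDefKernel Γ ∧
        ((∀ x i, Γ x x i i = 0) → IsNSPseudoCrossVariogram Γ)) := by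
  refine ⟨fun Γ hΓ => ?_, fun Γ C g hC h => ?_⟩
  · rcases Nat.eq_zero_or_pos m with rfl | hm
    · exact ⟨fun _ _ => 0, fun _ _ => 0, ⟨fun _ _ i => i.elim0, by simp⟩, fun _ _ i => i.elim0⟩
    · obtain ⟨hsymm, hneg⟩ := hΓ
      let i₀ : Fin m := ⟨0, hm⟩
      let g : Fin m → (Fin d → ℝ) → ℝ := fun i x => Γ x 0 i i₀ - Γ 0 0 i₀ i₀ / 2
      let C : (Fin d → ℝ) → (Fin d → ℝ) → Matrix (Fin m) (Fin m) ℝ :=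
        fun x y => Matrix.of fun i j => g i x + g j y - Γ x y i j
      have hC (x y : Fin d → ℝ) (i j : Fin m) : C x y i j = g i x + g j y - Γ x y i j := rfl
      refine ⟨g, C, .of_sum_eq_zero (fun x y i j => ?_) 0 i₀ (fun x i => ?_) fun n x a ha => ?_,
        fun x y i j => ?_⟩
      · rw [hC, hC, hsymm x y]
        ring
      · simp only [hC, g]
        ring
      · rw [kernel_sum_eq_neg_of_eq_add_sub hC x a ha]
        exact neg_nonneg.mpr (hneg n x a ha)
      · rw [hC]
        ring
  · have hΓ : IsCondNegDefKernel Γ := by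
      refine ⟨fun x y i j => ?_, fun n x a ha => ?_⟩
      · rw [h, h, hC.1 x y]
        ring
      · rw [kernel_sum_eq_neg_of_eq_add_sub h x a ha]
        exact neg_nonpos.mpr (hC.2 n x a)
    exact ⟨hΓ, fun hdiag => ⟨hΓ, hdiag⟩⟩
end

section
/- Let γ̃: ℝ^d × ℝ^d → ℝ^{m×m} be a matrix-valued kernel satisfying γ̃_ij(x,y) = γ̃_ji(x,y) = γ̃_ij(y,x) for all x,y,i,j, with γ̃_ii(x,x) = 0 for all x ∈ ℝ^d and i = 1,…,m, and such that the kernel (x,y) ↦ γ̃(x,0) + γ̃(y,0) − γ̃(x,y) is positive definite (these properties hold for every non-stationary cross-variogram). Then the kernel Γ: ℝ^d × ℝ^d → ℝ^{m×m} defined by γ_ij(x,y) = γ̃_ii(x,0) + γ̃_jj(y,0) − (γ̃_ij(x,0) + γ̃_ij(y,0) − γ̃_ij(x,y)) is a non-stationary pseudo cross-variogram. -/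
open Matrix MeasureTheory Real Set
open scoped BigOperators

/-- Subtracting a positive definite kernel from a kernel of the form `g_i(x) + g_j(y)` gives a
conditionally negative definite kernel. -/
theorem IsPosDefKernel.isCondNegDefKernel_add_sub {X : Type*} {m : ℕ}
    {C : X → X → Matrix (Fin m) (Fin m) ℝ} (hC : IsPosDefKernel C) (g : X → Fin m → ℝ) :
    IsCondNegDefKernel (fun x y => Matrix.of fun i j => g x i + g y j - C x y i j) := by
  refine ⟨fun x y i j => ?_, fun n x a ha => ?_⟩
  · simp only [Matrix.of_apply, hC.1 x y i j]
    ring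
  · have hterm : ∀ p q,
        a p ⬝ᵥ (Matrix.of fun i j => g (x p) i + g (x q) j - C (x p) (x q) i j).mulVec (a q) =
          (∑ i, a p i * g (x p) i) * (∑ j, a q j) + (∑ i, a p i) * (∑ j, g (x q) j * a q j) -
            a p ⬝ᵥ (C (x p) (x q)).mulVec (a q) := by
      intro p q
      rw [Finset.sum_mul_sum, Finset.sum_mul_sum]
      simp only [dotProduct, Matrix.mulVec, Matrix.of_apply, Finset.mul_sum,
        ← Finset.sum_add_distrib, ← Finset.sum_sub_distrib]
      refine Finset.sum_congr rfl fun i _ => Finset.sum_congr rfl fun j _ => ?_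
      ring
    simp only [hterm, Finset.sum_sub_distrib, Finset.sum_add_distrib, ← Finset.sum_mul_sum, ha,
      mul_zero, zero_mul, add_zero, zero_sub]
    exact neg_nonpos.mpr (hC.2 n x a)

/-- From a non-stationary cross-variogram `γ̃` (symmetric in indices and arguments,
vanishing diagonal, with `(x,y) ↦ γ̃(x,0) + γ̃(y,0) − γ̃(x,y)` positive definite) one constructs
the non-stationary pseudo cross-variogram
`γ_ij(x,y) = γ̃_ii(x,0) + γ̃_jj(y,0) − (γ̃_ij(x,0) + γ̃_ij(y,0) − γ̃_ij(x,y))`. -/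
theorem pseudo_variogram_from_cross_variogram {d m : ℕ}
    (γt : (Fin d → ℝ) → (Fin d → ℝ) → Matrix (Fin m) (Fin m) ℝ)
    (hsym1 : ∀ x y i j, γt x y i j = γt x y j i)
    (hsym2 : ∀ x y i j, γt x y i j = γt y x i j)
    (hdiag : ∀ x i, γt x x i i = 0)
    (hpd : IsPosDefKernel (fun x y => γt x 0 + γt y 0 - γt x y)) :
    IsNSPseudoCrossVariogram (fun x y => Matrix.of fun i j =>
      γt x 0 i i + γt y 0 j j - (γt x 0 i j + γt y 0 i j - γt x y i j)) := by
  refine ⟨hpd.isCondNegDefKernel_add_sub fun x i => γt x 0 i i, fun x i => ?_⟩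
  simp [hdiag x i]
end

section
/- Let γ̃: ℝ^d × ℝ^d → ℝ^{m×m} be a matrix-valued kernel satisfying γ̃_ij(x,y) = γ̃_ji(x,y) = γ̃_ij(y,x) for all x,y,i,j, with γ̃_ii(x,x) = 0 for all x ∈ ℝ^d and i = 1,…,m, and such that the kernel (x,y) ↦ γ̃(x,0) + γ̃(y,0) − γ̃(x,y) is positive definite (these properties hold for every non-stationary cross-variogram). Then the matrix-valued kernel with entries (x,y) ↦ exp(−γ̃_ii(x,0) − γ̃_jj(y,0) + γ̃_ij(x,0) + γ̃_ij(y,0) − γ̃_ij(x,y)), i,j = 1,…,m, is positive definite. -/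
open Matrix MeasureTheory Real Set
open scoped BigOperators

theorem Matrix.PosSemidef.map_pow_s3 {ι : Type*} [Finite ι] {A : Matrix ι ι ℝ}
    (hA : A.PosSemidef) (k : ℕ) : (A.map (· ^ k)).PosSemidef := by
  induction k with
  | zero =>
    have h := Matrix.posSemidef_vecMulVec_self_star (fun _ : ι => (1 : ℝ))
    convert h using 1
    ext i j
    simp [Matrix.vecMulVec_apply]
  | succ k ih =>
    have h : A.map (· ^ (k + 1)) = A.map (· ^ k) ⊙ A := by
      ext i j
      simp [pow_succ]
    rw [h]
    exact ih.hadamard hA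

theorem Matrix.posSemidef_real_iff_sum {ι : Type*} [Fintype ι] {A : Matrix ι ι ℝ} :
    A.PosSemidef ↔ (∀ i j, A i j = A j i) ∧ ∀ v : ι → ℝ, 0 ≤ ∑ i, ∑ j, v i * A i j * v j := by
  rw [Matrix.posSemidef_iff_dotProduct_mulVec]
  refine and_congr ?_ (forall_congr' fun v => ?_)
  · rw [Matrix.IsHermitian.ext_iff]
    exact ⟨fun h i j => (h i j).symm, fun h i j => (h i j).symm⟩
  · simp [dotProduct, mulVec, Finset.mul_sum, mul_assoc]

theorem Matrix.PosSemidef.map_exp {ι : Type*} [Fintype ι] {A : Matrix ι ι ℝ}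
    (hA : A.PosSemidef) : (A.map Real.exp).PosSemidef := by
  rw [Matrix.posSemidef_real_iff_sum]
  refine ⟨fun i j => congrArg Real.exp ((Matrix.posSemidef_real_iff_sum.1 hA).1 i j),
    fun v => ?_⟩
  have hsum : HasSum (fun k : ℕ => ∑ i, ∑ j, v i * (A i j ^ k / k.factorial) * v j)
      (∑ i, ∑ j, v i * Real.exp (A i j) * v j) := by
    refine hasSum_sum fun i _ => hasSum_sum fun j _ => ?_
    have h := NormedSpace.expSeries_div_hasSum_exp (A i j)
    rw [← Real.exp_eq_exp_ℝ] at h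
    exact (h.mul_left _).mul_right _
  refine hsum.nonneg fun k => ?_
  have h := (Matrix.posSemidef_real_iff_sum.1 (hA.map_pow_s3 k)).2 v
  convert div_nonneg h (Nat.cast_nonneg (α := ℝ) k.factorial) using 1
  simp only [Finset.sum_div, Matrix.map_apply]
  refine Finset.sum_congr rfl fun i _ => Finset.sum_congr rfl fun j _ => ?_
  ring

theorem sum_dotProduct_mulVec_eq_sum_prod {ι κ : Type*} [Fintype ι] [Fintype κ]
    (B : ι → ι → Matrix κ κ ℝ) (a : ι → κ → ℝ) :
    ∑ p, ∑ q, a p ⬝ᵥ (B p q).mulVec (a q) =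
      ∑ s : ι × κ, ∑ t : ι × κ, a s.1 s.2 * B s.1 t.1 s.2 t.2 * a t.1 t.2 := by
  simp only [Fintype.sum_prod_type, dotProduct, mulVec, Finset.mul_sum, mul_assoc]
  exact Finset.sum_congr rfl fun p _ => Finset.sum_comm

theorem isPosDefKernel_iff_posSemidef {X : Type*} {m : ℕ}
    {C : X → X → Matrix (Fin m) (Fin m) ℝ} :
    IsPosDefKernel C ↔ (∀ x y i j, C x y i j = C y x j i) ∧
      ∀ (n : ℕ) (x : Fin n → X), (Matrix.of fun s t : Fin n × Fin m =>
        C (x s.1) (x t.1) s.2 t.2).PosSemidef := by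
  refine and_congr_right fun hC => forall_congr' fun n => forall_congr' fun x => ?_
  rw [Matrix.posSemidef_real_iff_sum]
  refine ⟨fun h => ⟨fun s t => hC _ _ _ _, fun v => ?_⟩, fun h a => ?_⟩
  · have := h fun p i => v (p, i)
    rwa [sum_dotProduct_mulVec_eq_sum_prod fun p q => C (x p) (x q)] at this
  · rw [sum_dotProduct_mulVec_eq_sum_prod fun p q => C (x p) (x q)]
    exact h.2 fun s => a s.1 s.2

theorem IsPosDefKernel.exp {X : Type*} {m : ℕ} {C : X → X → Matrix (Fin m) (Fin m) ℝ}
    (hC : IsPosDefKernel C) : IsPosDefKernel fun x y => (C x y).map Real.exp := by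
  rw [isPosDefKernel_iff_posSemidef] at hC ⊢
  exact ⟨fun x y i j => congrArg Real.exp (hC.1 x y i j), fun n x => (hC.2 n x).map_exp⟩

theorem IsPosDefKernel.rescale {X : Type*} {m : ℕ} {C : X → X → Matrix (Fin m) (Fin m) ℝ}
    (hC : IsPosDefKernel C) (g : X → Fin m → ℝ) :
    IsPosDefKernel fun x y => Matrix.of fun i j => g x i * C x y i j * g y j := by
  refine ⟨fun x y i j => ?_, fun n x a => ?_⟩
  · simp only [Matrix.of_apply, hC.1 x y i j]
    ring
  · convert hC.2 n x fun p i => a p i * g (x p) i using 1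
    simp only [dotProduct, mulVec, Finset.mul_sum, Matrix.of_apply]
    refine Finset.sum_congr rfl fun p _ => Finset.sum_congr rfl fun q _ =>
      Finset.sum_congr rfl fun i _ => Finset.sum_congr rfl fun j _ => ?_
    ring

/-- For a non-stationary cross-variogram `γ̃` (symmetric in indices and arguments,
vanishing diagonal, with `(x,y) ↦ γ̃(x,0) + γ̃(y,0) − γ̃(x,y)` positive definite), the
matrix-valued kernel with entries
`exp(−γ̃_ii(x,0) − γ̃_jj(y,0) + γ̃_ij(x,0) + γ̃_ij(y,0) − γ̃_ij(x,y))` is positive definite. -/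
theorem exp_cross_variogram_posdef {d m : ℕ}
    (γt : (Fin d → ℝ) → (Fin d → ℝ) → Matrix (Fin m) (Fin m) ℝ)
    (hsym1 : ∀ x y i j, γt x y i j = γt x y j i)
    (hsym2 : ∀ x y i j, γt x y i j = γt y x i j)
    (hdiag : ∀ x i, γt x x i i = 0)
    (hpd : IsPosDefKernel (fun x y => γt x 0 + γt y 0 - γt x y)) :
    IsPosDefKernel (fun x y => Matrix.of fun i j =>
      Real.exp (-γt x 0 i i - γt y 0 j j + γt x 0 i j + γt y 0 i j - γt x y i j)) := by
  convert hpd.exp.rescale fun x i => Real.exp (-γt x 0 i i) using 4 with x y i j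
  ext j
  simp only [Matrix.map_apply, Matrix.sub_apply, Matrix.add_apply, ← Real.exp_add]
  ring_nf
end

section
/- Let γ: ℝ^d → ℝ^{m×m} be a pseudo cross-variogram and let z ∈ ℝ^d. Then the matrix-valued function C: ℝ^d → ℝ^{m×m} defined by C(h) = γ(h + z) + γ(h − z) − 2γ(h) is a positive definite matrix-valued function (i.e., a valid cross-covariance function). -/
open Matrix MeasureTheory Real Set
open scoped BigOperators

/-- For a pseudo cross-variogram `γ` and `z ∈ ℝ^d`, the matrix-valued function
`C(h) = γ(h + z) + γ(h − z) − 2γ(h)` is positive definite (a valid cross-covariance). -/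
theorem pseudo_variogram_second_difference_posdef {d m : ℕ}
    (γ : (Fin d → ℝ) → Matrix (Fin m) (Fin m) ℝ)
    (hγ : IsPseudoCrossVariogram γ) (z : Fin d → ℝ) :
    IsPosDefFun (fun h => γ (h + z) + γ (h - z) - 2 • γ h) := by
  obtain ⟨⟨hsymm, hneg⟩, -⟩ := hγ
  have hrefl (h : Fin d → ℝ) (i j : Fin m) : γ h i j = γ (-h) j i := by
    simpa using hsymm h 0 i j
  refine ⟨fun x y i j => ?_, fun n x a => ?_⟩
  · simp only [Matrix.sub_apply, Matrix.add_apply, Matrix.smul_apply]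
    rw [hrefl (x - y + z), hrefl (x - y - z), hrefl (x - y),
      show -(x - y + z) = y - x - z by abel, show -(x - y - z) = y - x + z by abel,
      neg_sub, add_comm (γ (y - x - z) j i)]
  · have key := hneg (n + n) (Fin.append x fun p => x p + z) (Fin.append a fun p => -a p)
      (by simp only [Fin.sum_univ_add, Fin.append_left, Fin.append_right, Pi.neg_apply,
        Finset.sum_neg_distrib, add_neg_cancel])
    have hshift (p q : Fin n) : x p - (x q + z) = x p - x q - z := by abel
    have hshift' (p q : Fin n) : x p + z - x q = x p - x q + z := by abel
    simp only [Fin.sum_univ_add, Fin.append_left, Fin.append_right, add_sub_add_right_eq_sub,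
      hshift, hshift', Matrix.mulVec_neg, dotProduct_neg, neg_dotProduct,
      Finset.sum_add_distrib, Finset.sum_neg_distrib] at key
    simp only [Matrix.sub_mulVec, Matrix.add_mulVec, dotProduct_sub,
      dotProduct_add, Finset.sum_add_distrib, Finset.sum_sub_distrib,
      two_nsmul]
    linarith
end

section
/- Let γ: ℝ^d → ℝ^{m×m} be a pseudo cross-variogram (with nonnegative entries), let z ∈ ℝ^d and c ≥ −1. Then the matrix-valued function C: ℝ^d → ℝ^{m×m} with entries C_ij(h) = (1 + γ_ij(h + z))·(1 + γ_ij(h − z)) / (1 + γ_ij(h))² + c, i,j = 1,…,m, is positive definite. -/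
open Matrix MeasureTheory Real Set
open scoped BigOperators

namespace Matrix

variable {κ : Type*}

theorem PosSemidef.map_pow_succ {M : Matrix κ κ ℝ} (hM : M.PosSemidef) (n : ℕ) :
    (M.map (· ^ (n + 1))).PosSemidef := by
  induction n with
  | zero => simpa using hM
  | succ n ih =>
    have h : M.map (· ^ (n + 1 + 1)) = (M.map (· ^ (n + 1))) ⊙ M := by
      ext k l
      simp [pow_succ]
    exact h ▸ ih.hadamard hM

variable [Fintype κ]

theorem posSemidef_vecMulVec_self (v : κ → ℝ) : (vecMulVec v v).PosSemidef := by
  simpa using posSemidef_vecMulVec_self_star v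

theorem dotProduct_mulVec_eq_sum (M : Matrix κ κ ℝ) (b : κ → ℝ) :
    b ⬝ᵥ M *ᵥ b = ∑ k, ∑ l, b k * b l * M k l := by
  simp only [dotProduct, mulVec, Finset.mul_sum]
  exact Finset.sum_congr rfl fun k _ => Finset.sum_congr rfl fun l _ => by ring

theorem posSemidef_of_tendsto {M : ℕ → Matrix κ κ ℝ} {A : Matrix κ κ ℝ}
    (hM : ∀ n, (M n).PosSemidef)
    (h : Filter.Tendsto M Filter.atTop (nhds A)) : A.PosSemidef := by
  refine .of_dotProduct_mulVec_nonneg ?_ fun b => ?_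
  · have hT : Filter.Tendsto (fun n => (M n)ᴴ) Filter.atTop (nhds Aᴴ) :=
      (continuous_id.matrix_conjTranspose.tendsto A).comp h
    simp only [(hM _).isHermitian.eq] at hT
    exact tendsto_nhds_unique hT h
  · have hc : Continuous fun B : Matrix κ κ ℝ => star b ⬝ᵥ B *ᵥ b := by fun_prop
    exact ge_of_tendsto' ((hc.tendsto A).comp h) fun n => (hM n).dotProduct_mulVec_nonneg b

/-- An entrywise power series with nonnegative coefficients and no constant term preserves
positive semidefiniteness. -/
theorem PosSemidef.of_hasSum_pow {M A : Matrix κ κ ℝ} (hM : M.PosSemidef) {c : ℕ → ℝ}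
    (hc : ∀ n, 0 ≤ c n) (h : ∀ k l, HasSum (fun n => c n * M k l ^ (n + 1)) (A k l)) :
    A.PosSemidef := by
  refine posSemidef_of_tendsto
    (M := fun N => ∑ n ∈ Finset.range N, c n • M.map (· ^ (n + 1)))
    (fun N => posSemidef_sum _ fun n _ => (hM.map_pow_succ n).smul (hc n)) ?_
  refine tendsto_pi_nhds.2 fun k => tendsto_pi_nhds.2 fun l => ?_
  simpa [Matrix.sum_apply] using (h k l).tendsto_sum_nat

theorem PosSemidef.map_exp_sub_one {M : Matrix κ κ ℝ} (hM : M.PosSemidef) :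
    (M.map fun t => Real.exp t - 1).PosSemidef := by
  refine hM.of_hasSum_pow (c := fun n => ((n + 1).factorial : ℝ)⁻¹) (fun n => by positivity)
    fun k l => ?_
  have h := NormedSpace.expSeries_div_hasSum_exp (M k l)
  rw [← Real.exp_eq_exp_ℝ, ← hasSum_nat_add_iff' 1] at h
  simpa [div_eq_inv_mul] using h

theorem PosSemidef.map_neg_log_one_sub {M : Matrix κ κ ℝ} (hM : M.PosSemidef)
    (h : ∀ k l, |M k l| < 1) : (M.map fun t => -Real.log (1 - t)).PosSemidef := by
  refine hM.of_hasSum_pow (c := fun n => ((n : ℝ) + 1)⁻¹) (fun n => by positivity)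
    fun k l => ?_
  simpa [div_eq_inv_mul] using Real.hasSum_pow_div_log_of_abs_lt_one (h k l)

/-- A real matrix whose quadratic form is nonpositive on vectors with zero coordinate sum. -/
def IsNegType (G : Matrix κ κ ℝ) : Prop :=
  G.IsSymm ∧ ∀ b : κ → ℝ, ∑ k, b k = 0 → ∑ k, ∑ l, b k * b l * G k l ≤ 0

namespace IsNegType

variable {G : Matrix κ κ ℝ}

/-- Schoenberg's centring of a matrix of negative type at the index `o`. -/
theorem posSemidef_centring [DecidableEq κ] (hG : G.IsNegType) (h0 : ∀ k, G k k = 0) (o : κ) :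
    (of fun k l => G k o + G l o - G k l).PosSemidef := by
  have hs : ∀ k l, G k l = G l k := fun k l => (hG.1.apply k l).symm
  refine .of_dotProduct_mulVec_nonneg ?_ fun b => ?_
  · ext k l
    simp [hs k l, add_comm]
  · have h := hG.2 (b - Pi.single o (∑ k, b k)) (by simp)
    rw [← dotProduct_mulVec_eq_sum] at h
    have e : (b - Pi.single o (∑ k, b k)) ⬝ᵥ G *ᵥ (b - Pi.single o (∑ k, b k)) =
        (b ⬝ᵥ G *ᵥ b) - 2 * ((∑ k, b k) * ∑ k, b k * G k o) := by
      have e1 : b ⬝ᵥ G *ᵥ Pi.single o (∑ k, b k) = (∑ k, b k) * ∑ k, b k * G k o := by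
        simp only [mulVec_single, dotProduct, Finset.mul_sum]
        exact Finset.sum_congr rfl fun k _ => by simp; ring
      have e2 : Pi.single o (∑ k, b k) ⬝ᵥ G *ᵥ b = (∑ k, b k) * ∑ k, b k * G k o := by
        rw [single_dotProduct]
        congr 1
        exact Finset.sum_congr rfl fun k _ => (congrArg (· * b k) (hs o k)).trans (mul_comm _ _)
      have e3 : Pi.single o (∑ k, b k) ⬝ᵥ G *ᵥ Pi.single o (∑ k, b k) = 0 := by
        simp [h0]
      rw [mulVec_sub, sub_dotProduct, dotProduct_sub, dotProduct_sub, e1, e2, e3]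
      ring
    have e' : star b ⬝ᵥ (of fun k l => G k o + G l o - G k l) *ᵥ b =
        2 * ((∑ k, b k) * ∑ k, b k * G k o) - b ⬝ᵥ G *ᵥ b := by
      rw [star_trivial, dotProduct_mulVec_eq_sum, dotProduct_mulVec_eq_sum, two_mul]
      nth_rw 2 [mul_comm]
      simp only [of_apply, Finset.sum_mul_sum, ← Finset.sum_add_distrib,
        ← Finset.sum_sub_distrib]
      rw [Finset.sum_congr rfl fun k _ => Finset.sum_congr rfl fun l _ => ?_]
      ring
    rw [e']
    linarith

theorem apply_le [DecidableEq κ] (hG : G.IsNegType) (h0 : ∀ k, G k k = 0) (k l o : κ) :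
    G k l ≤ 2 * (G k o + G l o) := by
  have h := (hG.posSemidef_centring h0 o).dotProduct_mulVec_nonneg
    (Pi.single k 1 + Pi.single l 1)
  have hs := hG.1.apply k l
  simp [mulVec_add, h0] at h
  linarith

/-- The Bernstein function `t ↦ log (1 + t)` preserves negative type. -/
theorem map_log_one_add (hG : G.IsNegType) (h0 : ∀ k, G k k = 0) (hnn : ∀ k l, 0 ≤ G k l) :
    (G.map fun t => Real.log (1 + t)).IsNegType := by
  classical
  refine ⟨hG.1.map _, fun b hb => ?_⟩
  rcases isEmpty_or_nonempty κ with _ | ⟨⟨o⟩⟩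
  · simp
  set f : κ → ℝ := fun k => G k o
  have hf0 : ∀ k, 0 ≤ f k := fun k => hnn k o
  set v : κ → ℝ := fun k => (1 + f k)⁻¹ with hv
  set M : Matrix κ κ ℝ :=
    (vecMulVec f f + of fun k l => G k o + G l o - G k l) ⊙ vecMulVec v v with hMdef
  have hM : M.PosSemidef :=
    ((posSemidef_vecMulVec_self f).add (hG.posSemidef_centring h0 o)).hadamard
      (posSemidef_vecMulVec_self v)
  have hMa : ∀ k l, M k l = 1 - (1 + G k l) / ((1 + f k) * (1 + f l)) := by
    intro k l
    have hk : 1 + f k ≠ 0 := by linarith [hf0 k]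
    have hl : 1 + f l ≠ 0 := by linarith [hf0 l]
    simp only [hMdef, hadamard_apply, add_apply, vecMulVec_apply, of_apply, hv]
    change (f k * f l + (f k + f l - G k l)) * _ = _
    field_simp
    ring
  have hpos : ∀ k l, 0 < (1 + f k) * (1 + f l) := fun k l => by
    have := hf0 k
    have := hf0 l
    positivity
  have hM1 : ∀ k l, |M k l| < 1 := by
    intro k l
    have hkl := hnn k l
    rw [hMa, abs_lt]
    constructor
    · have : (1 + G k l) / ((1 + f k) * (1 + f l)) < 2 := by
        rw [div_lt_iff₀ (hpos k l)]
        nlinarith [hG.apply_le h0 k l o, mul_nonneg (hf0 k) (hf0 l)]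
      linarith
    · have : 0 < (1 + G k l) / ((1 + f k) * (1 + f l)) := div_pos (by linarith) (hpos k l)
      linarith
  have hL := (hM.map_neg_log_one_sub hM1).dotProduct_mulVec_nonneg b
  rw [star_trivial, dotProduct_mulVec_eq_sum] at hL
  have hlog : ∀ k l, Real.log (1 + G k l) =
      Real.log (1 + f k) + Real.log (1 + f l) - -Real.log (1 - M k l) := by
    intro k l
    rw [hMa, sub_sub_cancel, Real.log_div (by linarith [hnn k l]) (hpos k l).ne',
      Real.log_mul (by linarith [hf0 k]) (by linarith [hf0 l])]
    ring
  have e : ∑ k, ∑ l, b k * b l * Real.log (1 + G k l) =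
      (∑ k, b k * Real.log (1 + f k)) * ∑ l, b l + (∑ k, b k) * ∑ l, b l * Real.log (1 + f l)
        - ∑ k, ∑ l, b k * b l * -Real.log (1 - M k l) := by
    simp only [Finset.sum_mul_sum, ← Finset.sum_add_distrib, ← Finset.sum_sub_distrib]
    refine Finset.sum_congr rfl fun k _ => Finset.sum_congr rfl fun l _ => ?_
    rw [hlog]
    ring
  simp only [map_apply] at hL ⊢
  rw [e, hb]
  linarith

end IsNegType

end Matrix

section Kernels

variable {X : Type*} {m : ℕ}

theorem IsCondNegDefKernel.isNegType {Γ : X → X → Matrix (Fin m) (Fin m) ℝ}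
    (hΓ : IsCondNegDefKernel Γ) {κ : Type*} [Fintype κ] (u : κ → X) (s : κ → Fin m) :
    (Matrix.of fun k l => Γ (u k) (u l) (s k) (s l)).IsNegType := by
  refine ⟨Matrix.IsSymm.ext fun k l => hΓ.1 _ _ _ _, fun b hb => ?_⟩
  let e := Fintype.equivFin κ
  have h := hΓ.2 (Fintype.card κ) (fun p => u (e.symm p))
    (fun p => Pi.single (s (e.symm p)) (b (e.symm p)))
    (by simpa using (Equiv.sum_comp e.symm b).trans hb)
  refine le_of_eq_of_le (Eq.trans ?_ (Equiv.sum_comp e.symm fun k => ∑ q, Pi.single (s k) (b k) ⬝ᵥ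
    (Γ (u k) (u (e.symm q))).mulVec (Pi.single (s (e.symm q)) (b (e.symm q)))).symm) h
  refine Finset.sum_congr rfl fun k _ => Eq.trans ?_ (Equiv.sum_comp e.symm fun l =>
    Pi.single (s k) (b k) ⬝ᵥ (Γ (u k) (u l)).mulVec (Pi.single (s l) (b l))).symm
  refine Finset.sum_congr rfl fun l _ => ?_
  rw [single_dotProduct, Matrix.mulVec, dotProduct_single, Matrix.of_apply]
  ring

theorem IsPosDefKernel.of_posSemidef {C : X → X → Matrix (Fin m) (Fin m) ℝ}
    (hC : ∀ (n : ℕ) (x : Fin n → X), (Matrix.of fun k l : Fin n × Fin m =>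
      C (x k.1) (x l.1) k.2 l.2).PosSemidef) : IsPosDefKernel C := by
  refine ⟨fun x y i j => ?_, fun n x a => ?_⟩
  · simpa using ((hC 2 ![x, y]).isHermitian.apply (0, i) (1, j)).symm
  · have h := (hC n x).dotProduct_mulVec_nonneg fun k => a k.1 k.2
    rw [star_trivial, Matrix.dotProduct_mulVec_eq_sum] at h
    refine le_of_le_of_eq h ?_
    simp only [Fintype.sum_prod_type, Matrix.of_apply, dotProduct, Matrix.mulVec, Finset.mul_sum]
    refine Finset.sum_congr rfl fun p _ => ?_
    rw [Finset.sum_comm]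
    refine Finset.sum_congr rfl fun q _ => Finset.sum_congr rfl fun i _ =>
      Finset.sum_congr rfl fun j _ => by ring

/-- The second difference of `log (1 + γ)` is positive semidefinite on finite families of points. -/
theorem IsPseudoCrossVariogram.posSemidef_log {V : Type*} [AddCommGroup V]
    {γ : V → Matrix (Fin m) (Fin m) ℝ} (hγ : IsPseudoCrossVariogram γ)
    (hnn : ∀ h i j, 0 ≤ γ h i j) (z : V) {κ : Type*} [Fintype κ] (x : κ → V) (s : κ → Fin m) :
    (Matrix.of fun k l => Real.log (1 + γ (x k - x l + z) (s k) (s l)) +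
      Real.log (1 + γ (x k - x l - z) (s k) (s l)) -
      2 * Real.log (1 + γ (x k - x l) (s k) (s l))).PosSemidef := by
  have hsymm : ∀ w w' : V, w' = -w → ∀ i j, γ w i j = γ w' j i := by
    rintro w _ rfl i j
    simpa using hγ.1.1 w 0 i j
  refine .of_dotProduct_mulVec_nonneg ?_ fun b => ?_
  · refine Matrix.IsHermitian.ext fun k l => ?_
    simp only [Matrix.of_apply, star_trivial]
    rw [hsymm (x l - x k + z) (x k - x l - z) (by abel),
      hsymm (x l - x k - z) (x k - x l + z) (by abel),
      hsymm (x l - x k) (x k - x l) (by abel), add_comm (Real.log _)]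
  · have h := ((hγ.1.isNegType (Sum.elim (fun k => x k + z) x) (Sum.elim s s)).map_log_one_add
      (fun k => by simp [hγ.2]) (fun k l => hnn _ _ _)).2 (Sum.elim b fun k => -b k) (by simp)
    simp only [Fintype.sum_sum_type, Sum.elim_inl, Sum.elim_inr, Matrix.map_apply,
      Matrix.of_apply, add_sub_add_right_eq_sub, ← Finset.sum_add_distrib] at h
    rw [star_trivial, Matrix.dotProduct_mulVec_eq_sum, ← neg_nonpos, ← Finset.sum_neg_distrib]
    refine le_of_eq_of_le (Finset.sum_congr rfl fun k _ => ?_) h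
    rw [← Finset.sum_neg_distrib]
    refine Finset.sum_congr rfl fun l _ => ?_
    rw [Matrix.of_apply, sub_add_eq_sub_sub, add_sub_right_comm (x k) z]
    ring

end Kernels

/-- For a pseudo cross-variogram `γ` with nonnegative entries, `z ∈ ℝ^d` and
`c ≥ −1`, the function with entries
`C_ij(h) = (1 + γ_ij(h+z))(1 + γ_ij(h−z))/(1 + γ_ij(h))² + c` is positive definite. -/
theorem ma_ratio_model_posdef {d m : ℕ}
    (γ : (Fin d → ℝ) → Matrix (Fin m) (Fin m) ℝ)
    (hγ : IsPseudoCrossVariogram γ) (hnn : ∀ h i j, 0 ≤ γ h i j)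
    (z : Fin d → ℝ) (c : ℝ) (hc : -1 ≤ c) :
    IsPosDefFun (fun h => Matrix.of fun i j =>
      (1 + γ (h + z) i j) * (1 + γ (h - z) i j) / (1 + γ h i j) ^ 2 + c) := by
  refine .of_posSemidef fun n x => ?_
  have hL := (hγ.posSemidef_log hnn z (fun k : Fin n × Fin m => x k.1) Prod.snd).map_exp_sub_one
  have hc' : (Matrix.vecMulVec (fun _ : Fin n × Fin m => (1 : ℝ)) fun _ => 1).PosSemidef :=
    Matrix.posSemidef_vecMulVec_self _
  convert hL.add (hc'.smul (by linarith : 0 ≤ 1 + c)) using 1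
  ext k l
  have hp : ∀ h, 0 < 1 + γ h k.2 l.2 := fun h => by linarith [hnn h k.2 l.2]
  simp only [Matrix.of_apply, Matrix.add_apply, Matrix.map_apply, Matrix.smul_apply,
    Matrix.vecMulVec_apply, Real.exp_sub, Real.exp_add, two_mul, Real.exp_log (hp _), pow_two,
    smul_eq_mul]
  ring
end

section
/- Let γ^S: ℝ^d → ℝ^{m×m} and γ^T: ℝ^k → ℝ^{m×m} be pseudo cross-variograms (with nonnegative entries). Let f_ij: [0,∞)² → ℝ, i,j = 1,…,m, be Lebesgue-integrable functions such that the matrix (f_ij(v,w))_{i,j=1,…,m} is symmetric and positive semi-definite for all v,w ≥ 0. Then the matrix-valued function C: ℝ^d × ℝ^k → ℝ^{m×m} with entries C_ij(h,u) = ∫_{[0,∞)²} exp(−v·γ^S_ij(h) − w·γ^T_ij(u)) f_ij(v,w) d(v,w) is a positive definite matrix-valued function on ℝ^{d+k}. -/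
open Matrix MeasureTheory Real Set
open scoped BigOperators

section Helpers

variable {ι : Type*} [Fintype ι]

theorem posSemidef_iff_sum_sum_nonneg {M : Matrix ι ι ℝ} :
    M.PosSemidef ↔ (∀ a b, M a b = M b a) ∧ ∀ x : ι → ℝ, 0 ≤ ∑ a, ∑ b, x a * M a b * x b := by
  rw [Matrix.posSemidef_iff_dotProduct_mulVec, Matrix.IsHermitian.ext_iff]
  refine and_congr ⟨fun h a b => (h b a).symm.trans ?_ |>.symm, fun h a b => ?_⟩ ?_
  · simp
  · simpa using h b a
  · simp [dotProduct, mulVec, Finset.mul_sum, mul_assoc]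

theorem posSemidef_entrywise_pow {B : Matrix ι ι ℝ} (hB : B.PosSemidef) (k : ℕ) :
    (Matrix.of fun a b => B a b ^ k).PosSemidef := by
  induction k with
  | zero =>
    convert Matrix.posSemidef_vecMulVec_self_star (fun _ : ι => (1 : ℝ)) using 1
    ext a b
    simp [vecMulVec_apply]
  | succ k ih =>
    have heq : (Matrix.of fun a b => B a b ^ (k + 1)) = (Matrix.of fun a b => B a b ^ k) ⊙ B := by
      ext a b
      simp [pow_succ]
    rw [heq]
    exact ih.hadamard hB

theorem posSemidef_entrywise_exp {B : Matrix ι ι ℝ} (hB : B.PosSemidef) :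
    (Matrix.of fun a b => Real.exp (B a b)).PosSemidef := by
  rw [posSemidef_iff_sum_sum_nonneg]
  refine ⟨fun a b => by simp [(posSemidef_iff_sum_sum_nonneg.1 hB).1 a b], fun x => ?_⟩
  have hsum : HasSum (fun k : ℕ => ∑ a, ∑ b, x a * (B a b ^ k / k.factorial) * x b)
      (∑ a, ∑ b, x a * Real.exp (B a b) * x b) := by
    refine hasSum_sum fun a _ => hasSum_sum fun b _ => ?_
    rw [Real.exp_eq_exp_ℝ]
    exact ((NormedSpace.expSeries_div_hasSum_exp (B a b)).mul_left _).mul_right _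
  refine hsum.nonneg fun k => ?_
  have h := (posSemidef_iff_sum_sum_nonneg.1 (posSemidef_entrywise_pow hB k)).2 x
  have hk : (0 : ℝ) ≤ (k.factorial : ℝ)⁻¹ := by positivity
  convert mul_nonneg hk h using 1
  simp only [Finset.mul_sum, of_apply]
  refine Finset.sum_congr rfl fun a _ => Finset.sum_congr rfl fun b _ => ?_
  ring

/-- The centering of a conditionally negative definite matrix at a point is positive
semidefinite. -/
theorem posSemidef_centering {G : Matrix ι ι ℝ} (hG : ∀ a b, G a b = G b a)
    (hneg : ∀ c : ι → ℝ, ∑ a, c a = 0 → ∑ a, ∑ b, c a * G a b * c b ≤ 0) (o : ι) :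
    (Matrix.of fun a b => G a o + G o b - G a b - G o o).PosSemidef := by
  classical
  rw [posSemidef_iff_sum_sum_nonneg]
  refine ⟨fun a b => by simp [hG a b, hG a o, hG b o]; ring, fun x => ?_⟩
  have h := hneg (fun a => x a - if a = o then ∑ b, x b else 0) (by simp)
  set s := ∑ b, x b with hs
  have h1 : ∑ a, ∑ b, (x a - if a = o then s else 0) * G a b * (x b - if b = o then s else 0) =
      (∑ a, ∑ b, x a * G a b * x b) - s * (∑ a, x a * G a o) - s * (∑ b, G o b * x b)
        + s * s * G o o := by
    simp only [sub_mul, mul_sub, Finset.sum_sub_distrib, ite_mul, mul_ite, zero_mul, mul_zero,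
      Finset.sum_ite_eq', Finset.mem_univ, if_true, Finset.sum_ite_irrel, Finset.sum_const_zero]
    simp only [← Finset.sum_mul]
    simp only [mul_assoc, ← Finset.mul_sum]
    ring
  have h2 : ∑ a, ∑ b, x a * (G a o + G o b - G a b - G o o) * x b =
      s * (∑ a, x a * G a o) + s * (∑ b, G o b * x b) - (∑ a, ∑ b, x a * G a b * x b)
        - s * s * G o o := by
    simp only [sub_mul, mul_sub, add_mul, mul_add, Finset.sum_sub_distrib, Finset.sum_add_distrib]
    simp only [mul_assoc, ← Finset.mul_sum]
    rw [← hs]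
    simp only [← mul_assoc, ← Finset.sum_mul]
    ring
  simp only [of_apply]
  linarith

/-- Schoenberg's theorem, finite version. -/
theorem posSemidef_exp_neg_of_condNegDef {G : Matrix ι ι ℝ} (hG : ∀ a b, G a b = G b a)
    (hneg : ∀ c : ι → ℝ, ∑ a, c a = 0 → ∑ a, ∑ b, c a * G a b * c b ≤ 0) {v : ℝ} (hv : 0 ≤ v) :
    (Matrix.of fun a b => Real.exp (-v * G a b)).PosSemidef := by
  rcases isEmpty_or_nonempty ι with hι | ⟨⟨o⟩⟩
  · simp [posSemidef_iff_sum_sum_nonneg]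
  have hB := posSemidef_entrywise_exp ((posSemidef_centering hG hneg o).smul hv)
  have hR := Matrix.posSemidef_vecMulVec_self_star
    (fun a => Real.exp (-v * G a o))
  have heq : (Matrix.of fun a b => Real.exp (-v * G a b)) = Real.exp (v * G o o) •
      ((Matrix.of fun a b => Real.exp
        ((v • Matrix.of fun a b => G a o + G o b - G a b - G o o) a b)) ⊙
      vecMulVec (fun a => Real.exp (-v * G a o)) (star fun a => Real.exp (-v * G a o))) := by
    ext a b
    simp only [of_apply, Matrix.smul_apply, hadamard_apply, vecMulVec_apply,
      star_trivial, smul_eq_mul, ← Real.exp_add]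
    rw [hG o b]
    congr 1
    ring
  rw [heq]
  exact (hB.hadamard hR).smul (Real.exp_pos (v * G o o)).le

end Helpers

/-- The block matrix of a conditionally negative definite kernel at finitely many points has a
positive semidefinite entrywise exponential. -/
theorem IsCondNegDefKernel.posSemidef_exp_neg {X : Type*} {m n : ℕ}
    {Γ : X → X → Matrix (Fin m) (Fin m) ℝ} (h : IsCondNegDefKernel Γ) (x : Fin n → X)
    {v : ℝ} (hv : 0 ≤ v) :
    (Matrix.of fun a b : Fin n × Fin m =>
      Real.exp (-v * Γ (x a.1) (x b.1) a.2 b.2)).PosSemidef := by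
  refine posSemidef_exp_neg_of_condNegDef
    (G := Matrix.of fun a b : Fin n × Fin m => Γ (x a.1) (x b.1) a.2 b.2)
    (fun a b => h.1 _ _ _ _) (fun c hc => ?_) hv
  rw [Fintype.sum_prod_type] at hc
  convert h.2 n x (fun p i => c (p, i)) hc using 1
  simp only [Fintype.sum_prod_type, dotProduct, mulVec, of_apply, Finset.mul_sum, mul_assoc]
  exact Finset.sum_congr rfl fun p _ => Finset.sum_comm

/-- Mixture construction (matrix-valued Gneiting-type mixture). For pseudo
cross-variograms `γ^S`, `γ^T` with nonnegative entries and Lebesgue-integrable functions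
`f_ij` on `[0,∞)²` forming a symmetric positive semi-definite matrix pointwise, the function
with entries `C_ij(h,u) = ∫_{[0,∞)²} exp(−v γ^S_ij(h) − w γ^T_ij(u)) f_ij(v,w) d(v,w)`
is a positive definite matrix-valued function on `ℝ^d × ℝ^k`. -/
theorem laplace_mixture_posdef {d k m : ℕ}
    (γS : (Fin d → ℝ) → Matrix (Fin m) (Fin m) ℝ)
    (γT : (Fin k → ℝ) → Matrix (Fin m) (Fin m) ℝ)
    (hS : IsPseudoCrossVariogram γS) (hSnn : ∀ h i j, 0 ≤ γS h i j)
    (hT : IsPseudoCrossVariogram γT) (hTnn : ∀ u i j, 0 ≤ γT u i j)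
    (f : Fin m → Fin m → ℝ → ℝ → ℝ)
    (hint : ∀ i j, IntegrableOn (fun vw : ℝ × ℝ => f i j vw.1 vw.2) (Ici 0 ×ˢ Ici 0))
    (hsymm : ∀ v w, 0 ≤ v → 0 ≤ w → ∀ i j, f i j v w = f j i v w)
    (hpsd : ∀ v w, 0 ≤ v → 0 ≤ w → (Matrix.of fun i j => f i j v w).PosSemidef) :
    IsPosDefFun (fun hu : (Fin d → ℝ) × (Fin k → ℝ) => Matrix.of fun i j =>
      ∫ vw in (Ici (0:ℝ) ×ˢ Ici (0:ℝ)),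
        Real.exp (-vw.1 * γS hu.1 i j - vw.2 * γT hu.2 i j) * f i j vw.1 vw.2) := by
  refine ⟨fun x y i j => ?_, fun n x a => ?_⟩
  · simp only [of_apply]
    refine setIntegral_congr_fun (measurableSet_Ici.prod measurableSet_Ici) fun vw hvw => ?_
    have h1 := hS.1.1 x.1 y.1 i j
    have h2 := hT.1.1 x.2 y.2 i j
    simp only [Prod.fst_sub, Prod.snd_sub] at h1 h2 ⊢
    rw [h1, h2, hsymm _ _ hvw.1 hvw.2]
  have hI : ∀ p q i j, IntegrableOn (fun vw : ℝ × ℝ => a p i * (Real.exp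
      (-vw.1 * γS (x p - x q).1 i j - vw.2 * γT (x p - x q).2 i j) * f i j vw.1 vw.2 * a q j))
      (Ici 0 ×ˢ Ici 0) := by
    intro p q i j
    refine Integrable.const_mul (Integrable.mul_const ?_ _) _
    refine (hint i j).norm.mono' ?_ ?_
    · exact (Continuous.aestronglyMeasurable (by fun_prop)).mul (hint i j).aestronglyMeasurable
    · refine (ae_restrict_iff' (measurableSet_Ici.prod measurableSet_Ici)).2 (.of_forall ?_)
      intro vw hvw
      rw [norm_mul, Real.norm_of_nonneg (Real.exp_pos _).le]
      refine mul_le_of_le_one_left (norm_nonneg _) (Real.exp_le_one_iff.2 ?_)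
      have h1 := mul_nonneg (mem_Ici.1 hvw.1) (hSnn (x p - x q).1 i j)
      have h2 := mul_nonneg (mem_Ici.1 hvw.2) (hTnn (x p - x q).2 i j)
      linarith
  have key : ∑ p, ∑ q, ∑ i, ∑ j, ∫ vw in Ici (0 : ℝ) ×ˢ Ici (0 : ℝ), a p i * (Real.exp
      (-vw.1 * γS (x p - x q).1 i j - vw.2 * γT (x p - x q).2 i j) * f i j vw.1 vw.2 * a q j) =
      ∫ vw in Ici (0 : ℝ) ×ˢ Ici (0 : ℝ), ∑ p, ∑ q, ∑ i, ∑ j, a p i * (Real.exp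
      (-vw.1 * γS (x p - x q).1 i j - vw.2 * γT (x p - x q).2 i j) * f i j vw.1 vw.2 * a q j) := by
    have hI1 := fun p q i => integrable_finsetSum Finset.univ fun j _ => hI p q i j
    have hI2 := fun p q => integrable_finsetSum Finset.univ fun i _ => hI1 p q i
    have hI3 := fun p => integrable_finsetSum Finset.univ fun q _ => hI2 p q
    rw [integral_finsetSum _ fun p _ => hI3 p]
    refine Finset.sum_congr rfl fun p _ => ?_
    rw [integral_finsetSum _ fun q _ => hI2 p q]
    refine Finset.sum_congr rfl fun q _ => ?_
    rw [integral_finsetSum _ fun i _ => hI1 p q i]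
    refine Finset.sum_congr rfl fun i _ => ?_
    rw [integral_finsetSum _ fun j _ => hI p q i j]
  simp only [dotProduct, mulVec, of_apply, Finset.mul_sum, ← integral_mul_const,
    ← integral_const_mul]
  rw [key]
  refine setIntegral_nonneg (measurableSet_Ici.prod measurableSet_Ici) fun vw hvw => ?_
  have hM := ((hS.1.posSemidef_exp_neg (fun p => (x p).1) hvw.1).hadamard
    (hT.1.posSemidef_exp_neg (fun p => (x p).2) hvw.2)).hadamard
    ((hpsd vw.1 vw.2 hvw.1 hvw.2).submatrix (Prod.snd : Fin n × Fin m → Fin m))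
  convert (posSemidef_iff_sum_sum_nonneg.1 hM).2 (fun c => a c.1 c.2) using 1
  simp only [Fintype.sum_prod_type, hadamard_apply, of_apply, submatrix_apply, ← Real.exp_add,
    Prod.fst_sub, Prod.snd_sub]
  refine Finset.sum_congr rfl fun p _ => ?_
  rw [Finset.sum_comm]
  refine Finset.sum_congr rfl fun i _ => Finset.sum_congr rfl fun q _ =>
    Finset.sum_congr rfl fun j _ => ?_
  ring_nf
end

section
/- Let γ^S: ℝ^d → ℝ^{m×m} and γ^T: ℝ^k → ℝ^{m×m} be pseudo cross-variograms (with nonnegative entries). Let μ_0, μ_1, μ_2 be probability measures on [0,∞) with Laplace transforms L_p(x) = ∫_{[0,∞)} exp(−x t) dμ_p(t), p = 0,1,2. Then the matrix-valued function C: ℝ^d × ℝ^k → ℝ^{m×m} with entries C_ij(h,u) = L_0(γ^S_ij(h) + γ^T_ij(u)) · L_1(γ^S_ij(h)) · L_2(γ^T_ij(u)), i,j = 1,…,m, is a positive definite matrix-valued function on ℝ^{d+k}. -/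
open Matrix MeasureTheory Real Set
open scoped BigOperators

/-- The matrix obtained from a conditionally negative definite matrix by centring at a base
point is positive semidefinite. -/
theorem posSemidef_centring_of_condNeg {ι : Type*} [Fintype ι] [DecidableEq ι]
    {G : Matrix ι ι ℝ} (hsymm : ∀ p q, G p q = G q p)
    (hG : ∀ v : ι → ℝ, ∑ p, v p = 0 → v ⬝ᵥ G *ᵥ v ≤ 0) (o : ι) :
    (Matrix.of fun p q => G p o + G o q - G p q - G o o).PosSemidef := by
  refine PosSemidef.of_dotProduct_mulVec_nonneg ?_ fun v => ?_
  · ext p q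
    simp only [conjTranspose_apply, of_apply, star_trivial]
    rw [hsymm q o, hsymm o p, hsymm q p]
    ring
  · set s := ∑ p, v p with hs
    have hw := hG (v - Pi.single o s) (by simp [← hs])
    have hcol : v ⬝ᵥ G.col o = (G *ᵥ v) o := by
      simp only [mulVec, dotProduct, col_apply]
      exact Finset.sum_congr rfl fun p _ => by rw [hsymm p o, mul_comm]
    have hB : (Matrix.of fun p q => G p o + G o q - G p q - G o o) *ᵥ v =
        fun p => s * G p o + (G *ᵥ v) o - (G *ᵥ v) p - s * G o o := by
      ext p
      simp only [mulVec, dotProduct, of_apply, sub_mul, add_mul, Finset.sum_sub_distrib,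
        Finset.sum_add_distrib, ← Finset.mul_sum, ← hs]
      ring
    have hvB : v ⬝ᵥ (fun p => s * G p o + (G *ᵥ v) o - (G *ᵥ v) p - s * G o o) =
        2 * s * (G *ᵥ v) o - v ⬝ᵥ G *ᵥ v - s * s * G o o := by
      have h1 : v ⬝ᵥ (fun p => s * G p o + (G *ᵥ v) o - (G *ᵥ v) p - s * G o o) =
          s * (v ⬝ᵥ G.col o) + s * (G *ᵥ v) o - v ⬝ᵥ G *ᵥ v - s * (s * G o o) := by
        simp only [dotProduct, col_apply, mul_sub, mul_add, Finset.sum_sub_distrib,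
          Finset.sum_add_distrib, ← Finset.sum_mul, ← hs, Finset.mul_sum]
        simp only [mul_left_comm]
      rw [h1, hcol]
      ring
    rw [star_trivial, hB, hvB]
    simp only [mulVec_sub, sub_dotProduct, dotProduct_sub, mulVec_single, single_dotProduct,
      op_smul_eq_smul, dotProduct_smul, hcol, col_apply, smul_eq_mul] at hw
    linarith

/-- The entrywise powers of a positive semidefinite matrix are positive semidefinite. -/
theorem Matrix.PosSemidef.map_pow_s7 {ι : Type*} [Fintype ι] {B : Matrix ι ι ℝ}
    (hB : B.PosSemidef) (k : ℕ) : (B.map (· ^ k)).PosSemidef := by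
  induction k with
  | zero =>
    have h : B.map (· ^ 0) = vecMulVec (fun _ => 1) (star fun _ => 1) := by
      ext p q
      simp [vecMulVec_apply]
    exact h ▸ posSemidef_vecMulVec_self_star fun _ => 1
  | succ k ih =>
    have h : B.map (· ^ (k + 1)) = B.map (· ^ k) ⊙ B := by
      ext p q
      simp [pow_succ]
    exact h ▸ ih.hadamard hB

/-- The entrywise exponential of a positive semidefinite matrix is positive semidefinite. -/
theorem Matrix.PosSemidef.map_exp_s7 {ι : Type*} [Fintype ι] {B : Matrix ι ι ℝ}
    (hB : B.PosSemidef) : (B.map Real.exp).PosSemidef := by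
  refine PosSemidef.of_dotProduct_mulVec_nonneg (hB.isHermitian.map _ fun _ => rfl) fun v => ?_
  have hsum : HasSum (fun k : ℕ => ((k.factorial : ℝ)⁻¹) * (star v ⬝ᵥ B.map (· ^ k) *ᵥ v))
      (star v ⬝ᵥ B.map Real.exp *ᵥ v) := by
    simp only [dotProduct, mulVec, Finset.mul_sum, Matrix.map_apply]
    refine hasSum_sum fun p _ => hasSum_sum fun q _ => ?_
    have h := NormedSpace.expSeries_div_hasSum_exp (B p q)
    rw [← Real.exp_eq_exp_ℝ] at h
    rw [mul_comm (Real.exp _), ← mul_assoc]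
    refine (h.mul_left (star v p * v q)).congr_fun fun k => ?_
    ring
  exact hsum.nonneg fun k =>
    mul_nonneg (by positivity) ((hB.map_pow_s7 k).dotProduct_mulVec_nonneg v)

/-- Schoenberg's theorem: `exp (-G t)` is positive semidefinite if `G` is conditionally negative
definite and `t ≥ 0`. -/
theorem posSemidef_exp_neg_of_condNeg {ι : Type*} [Fintype ι]
    {G : Matrix ι ι ℝ} (hsymm : ∀ p q, G p q = G q p)
    (hG : ∀ v : ι → ℝ, ∑ p, v p = 0 → v ⬝ᵥ G *ᵥ v ≤ 0) {t : ℝ} (ht : 0 ≤ t) :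
    (Matrix.of fun p q => Real.exp (-G p q * t)).PosSemidef := by
  classical
  rcases isEmpty_or_nonempty ι with _ | ⟨⟨o⟩⟩
  · exact PosSemidef.of_dotProduct_mulVec_nonneg (Subsingleton.elim _ _) (by simp)
  have h1 := ((posSemidef_centring_of_condNeg hsymm hG o).smul ht).map_exp_s7
  have h2 := posSemidef_vecMulVec_self_star (fun p => Real.exp (t * (G o o / 2 - G p o)))
  refine cast (congrArg PosSemidef ?_) (h1.hadamard h2)
  ext p q
  simp only [of_apply, hadamard_apply, Matrix.map_apply, Matrix.smul_apply, vecMulVec_apply,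
    star_trivial, smul_eq_mul, ← Real.exp_add, hsymm o q]
  ring_nf

/-- The entrywise integral of almost everywhere positive semidefinite matrices is positive
semidefinite. -/
theorem posSemidef_integral {ι Ω : Type*} [Fintype ι] [MeasurableSpace Ω] {ν : Measure Ω}
    {M : Ω → Matrix ι ι ℝ} (hint : ∀ p q, Integrable (fun ω => M ω p q) ν)
    (hM : ∀ᵐ ω ∂ν, (M ω).PosSemidef) :
    (Matrix.of fun p q => ∫ ω, M ω p q ∂ν).PosSemidef := by
  refine PosSemidef.of_dotProduct_mulVec_nonneg ?_ fun v => ?_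
  · ext p q
    simp only [conjTranspose_apply, of_apply, star_trivial]
    refine integral_congr_ae ?_
    filter_upwards [hM] with ω hω
    simpa using hω.isHermitian.apply p q
  · have h : star v ⬝ᵥ (Matrix.of fun p q => ∫ ω, M ω p q ∂ν) *ᵥ v =
        ∫ ω, star v ⬝ᵥ M ω *ᵥ v ∂ν := by
      simp only [dotProduct, mulVec, of_apply]
      rw [integral_finsetSum _ fun p _ => (integrable_finsetSum _ fun q _ =>
        (hint p q).mul_const _).const_mul _]
      refine Finset.sum_congr rfl fun p _ => ?_
      rw [integral_const_mul, integral_finsetSum _ fun q _ => (hint p q).mul_const _]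
      simp only [integral_mul_const]
    rw [h]
    refine integral_nonneg_of_ae ?_
    filter_upwards [hM] with ω hω using hω.dotProduct_mulVec_nonneg v

/-- The entrywise Laplace transform of a measure on `[0, ∞)` maps nonnegative conditionally
negative definite matrices to positive semidefinite ones. -/
theorem posSemidef_laplace_of_condNeg {ι : Type*} [Fintype ι] {G : Matrix ι ι ℝ}
    (hsymm : ∀ p q, G p q = G q p)
    (hG : ∀ v : ι → ℝ, ∑ p, v p = 0 → v ⬝ᵥ G *ᵥ v ≤ 0) (hnn : ∀ p q, 0 ≤ G p q)
    (ν : Measure ℝ) [IsFiniteMeasure ν] (hν : ν (Iio 0) = 0) :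
    (Matrix.of fun p q => ∫ t, Real.exp (-G p q * t) ∂ν).PosSemidef := by
  have hpos : ∀ᵐ t ∂ν, 0 ≤ t := by
    rw [ae_iff]
    simp only [not_le]
    exact hν
  refine posSemidef_integral (M := fun t => Matrix.of fun p q => Real.exp (-G p q * t))
    (fun p q => ?_) ?_
  · refine Integrable.of_bound (C := 1) (by simp only [of_apply]; fun_prop) ?_
    filter_upwards [hpos] with t ht
    simpa using mul_nonneg (hnn p q) ht
  · filter_upwards [hpos] with t ht using posSemidef_exp_neg_of_condNeg hsymm hG ht

theorem sum_dotProduct_mulVec_eq_s7 {n m : ℕ} (K : Fin n → Fin n → Matrix (Fin m) (Fin m) ℝ)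
    (a : Fin n → Fin m → ℝ) :
    ∑ p, ∑ q, a p ⬝ᵥ K p q *ᵥ a q =
      (fun r : Fin n × Fin m => a r.1 r.2) ⬝ᵥ
        (Matrix.of fun r s : Fin n × Fin m => K r.1 s.1 r.2 s.2) *ᵥ fun r => a r.1 r.2 := by
  simp only [dotProduct, mulVec, of_apply, Fintype.sum_prod_type, Finset.mul_sum]
  exact Finset.sum_congr rfl fun p _ => Finset.sum_comm

theorem IsCondNegDefKernel.condNeg_of {X : Type*} {m n : ℕ}
    {Γ : X → X → Matrix (Fin m) (Fin m) ℝ} (h : IsCondNegDefKernel Γ) (x : Fin n → X)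
    (v : Fin n × Fin m → ℝ) (hv : ∑ r, v r = 0) :
    v ⬝ᵥ (Matrix.of fun r s : Fin n × Fin m => Γ (x r.1) (x s.1) r.2 s.2) *ᵥ v ≤ 0 := by
  have := h.2 n x (fun p i => v (p, i)) (by rw [← hv, Fintype.sum_prod_type])
  rwa [sum_dotProduct_mulVec_eq_s7 (fun p q => Γ (x p) (x q))] at this

/-- For pseudo cross-variograms `γ^S`, `γ^T` with nonnegative entries and
Laplace transforms `L_0, L_1, L_2` of probability measures on `[0,∞)`, the function with
entries `C_ij(h,u) = L_0(γ^S_ij(h) + γ^T_ij(u)) · L_1(γ^S_ij(h)) · L_2(γ^T_ij(u))` is a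
positive definite matrix-valued function on `ℝ^d × ℝ^k`. -/
theorem laplace_product_posdef {d k m : ℕ}
    (γS : (Fin d → ℝ) → Matrix (Fin m) (Fin m) ℝ)
    (γT : (Fin k → ℝ) → Matrix (Fin m) (Fin m) ℝ)
    (hS : IsPseudoCrossVariogram γS) (hSnn : ∀ h i j, 0 ≤ γS h i j)
    (hT : IsPseudoCrossVariogram γT) (hTnn : ∀ u i j, 0 ≤ γT u i j)
    (μ : Fin 3 → Measure ℝ)
    (hprob : ∀ p, IsProbabilityMeasure (μ p))
    (hsupp : ∀ p, μ p (Iio 0) = 0) :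
    IsPosDefFun (fun hu : (Fin d → ℝ) × (Fin k → ℝ) => Matrix.of fun i j =>
      (∫ t, Real.exp (-(γS hu.1 i j + γT hu.2 i j) * t) ∂(μ 0)) *
      (∫ t, Real.exp (-(γS hu.1 i j) * t) ∂(μ 1)) *
      (∫ t, Real.exp (-(γT hu.2 i j) * t) ∂(μ 2))) := by
  obtain ⟨hS, -⟩ := hS
  obtain ⟨hT, -⟩ := hT
  refine ⟨fun x y i j => ?_, fun n x a => ?_⟩
  · simp only [of_apply, Prod.fst_sub, Prod.snd_sub, hS.1 x.1 y.1 i j, hT.1 x.2 y.2 i j]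
  · let GS : Matrix (Fin n × Fin m) (Fin n × Fin m) ℝ :=
      Matrix.of fun r s => γS ((x r.1).1 - (x s.1).1) r.2 s.2
    let GT : Matrix (Fin n × Fin m) (Fin n × Fin m) ℝ :=
      Matrix.of fun r s => γT ((x r.1).2 - (x s.1).2) r.2 s.2
    have sS : ∀ r s, GS r s = GS s r := fun r s => hS.1 _ _ _ _
    have sT : ∀ r s, GT r s = GT s r := fun r s => hT.1 _ _ _ _
    have cS := hS.condNeg_of fun p => (x p).1
    have cT := hT.condNeg_of fun p => (x p).2
    have h0 := posSemidef_laplace_of_condNeg (G := GS + GT)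
      (fun r s => by rw [Matrix.add_apply, Matrix.add_apply, sS, sT])
      (fun v hv => by
        rw [add_mulVec, dotProduct_add]
        exact add_nonpos (cS v hv) (cT v hv))
      (fun r s => add_nonneg (hSnn _ _ _) (hTnn _ _ _)) (μ 0) (hsupp 0)
    have h1 := posSemidef_laplace_of_condNeg sS cS (fun r s => hSnn _ _ _) (μ 1) (hsupp 1)
    have h2 := posSemidef_laplace_of_condNeg sT cT (fun r s => hTnn _ _ _) (μ 2) (hsupp 2)
    rw [sum_dotProduct_mulVec_eq_s7]
    exact ((h0.hadamard h1).hadamard h2).dotProduct_mulVec_nonneg fun r => a r.1 r.2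
end

section
/- Let γ^1,…,γ^n: ℝ → ℝ^{m×m} be pseudo cross-variograms (with nonnegative entries), Σ a symmetric positive definite d×d real matrix, Σ_1,…,Σ_n symmetric positive semi-definite d×d real matrices, and for i,j = 1,…,m and u ∈ ℝ set A_ij(u) = Σ + ∑_{ℓ=1}^n γ^ℓ_ij(u) Σ_ℓ. Let θ ∈ ℝ^d, and let f_ij: [0,∞) → ℝ, i,j = 1,…,m, be Lebesgue-integrable functions such that the matrix (f_ij(ω))_{i,j=1,…,m} is symmetric and positive semi-definite for all ω ≥ 0; write L_ij(x) = ∫_0^∞ exp(−ω x) f_ij(ω) dω. Then the matrix-valued function C: ℝ^d × ℝ → ℝ^{m×m} with entries C_ij(h,u) = det(A_ij(u))^{−1/2} · L_ij((1/2)(h + θu)ᵀ A_ij(u)^{−1} (h + θu)), i,j = 1,…,m, is a positive definite matrix-valued function on ℝ^{d+1}. -/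
open Matrix MeasureTheory Real Set
open scoped BigOperators

section FiniteKernels

theorem Matrix.PosSemidef.of_mul {ι : Type*} {M N : Matrix ι ι ℝ}
    (hM : M.PosSemidef) (hN : N.PosSemidef) :
    (Matrix.of fun i j => M i j * N i j).PosSemidef :=
  hM.hadamard hN

variable {ι : Type*} [Fintype ι]

theorem posSemidef_iff_sum_mul_nonneg {M : Matrix ι ι ℝ} :
    M.PosSemidef ↔
      (∀ i j, M i j = M j i) ∧ ∀ x : ι → ℝ, 0 ≤ ∑ i, ∑ j, x i * (M i j * x j) := by
  rw [posSemidef_iff_dotProduct_mulVec]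
  refine and_congr ⟨fun h i j => by simpa using (h.apply i j).symm, fun h => ?_⟩ ?_
  · ext i j
    simpa using h j i
  · simp [dotProduct, mulVec, Finset.mul_sum]

theorem posSemidef_of_mul_self (g : ι → ℝ) : (Matrix.of fun i j => g i * g j).PosSemidef :=
  posSemidef_vecMulVec_self_star g

/-- The entrywise exponential preserves positive semidefiniteness. -/
theorem Matrix.PosSemidef.of_exp {K : Matrix ι ι ℝ} (hK : K.PosSemidef) :
    (Matrix.of fun i j => Real.exp (K i j)).PosSemidef := by
  have hpow : ∀ k : ℕ, (Matrix.of fun i j => K i j ^ k).PosSemidef := by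
    intro k
    induction k with
    | zero =>
      simpa using posSemidef_of_mul_self (fun _ : ι => (1 : ℝ))
    | succ k ih =>
      simp only [pow_succ]
      exact ih.of_mul hK
  refine posSemidef_iff_sum_mul_nonneg.2
    ⟨fun i j => by simp [(posSemidef_iff_sum_mul_nonneg.1 hK).1 i j], fun x => ?_⟩
  have hs : HasSum (fun k : ℕ => ∑ i, ∑ j, x i * (K i j ^ k / k.factorial * x j))
      (∑ i, ∑ j, x i * (Real.exp (K i j) * x j)) :=
    hasSum_sum fun i _ => hasSum_sum fun j _ =>
      ((Real.exp_eq_exp_ℝ ▸ NormedSpace.expSeries_div_hasSum_exp (K i j)).mul_right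
        (x j)).mul_left (x i)
  refine hs.nonneg fun k => ?_
  have h := (posSemidef_iff_sum_mul_nonneg.1 (hpow k)).2 x
  have : ∑ i, ∑ j, x i * (K i j ^ k / k.factorial * x j) =
      (∑ i, ∑ j, x i * (K i j ^ k * x j)) / k.factorial := by
    simp_rw [Finset.sum_div]
    exact Finset.sum_congr rfl fun i _ => Finset.sum_congr rfl fun j _ => by ring
  rw [this]
  exact div_nonneg h (by positivity)

/-- Schoenberg's theorem for finite matrices: if `G` is conditionally negative definite, then
`exp (-G)` (entrywise) is positive semidefinite. -/
theorem posSemidef_exp_neg_of_condNegDef_s10 {G : ι → ι → ℝ} (hsymm : ∀ i j, G i j = G j i)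
    (hG : ∀ x : ι → ℝ, ∑ i, x i = 0 → ∑ i, ∑ j, x i * (G i j * x j) ≤ 0) :
    (Matrix.of fun i j => Real.exp (-G i j)).PosSemidef := by
  classical
  rcases isEmpty_or_nonempty ι with _ | ⟨⟨o⟩⟩
  · exact posSemidef_iff_sum_mul_nonneg.2 ⟨fun i => isEmptyElim i, fun x => by simp⟩
  have hK : (Matrix.of fun i j => G i o + G o j - G i j - G o o).PosSemidef := by
    refine posSemidef_iff_sum_mul_nonneg.2 ⟨fun i j => ?_, fun x => ?_⟩
    · simp only [of_apply, hsymm i o, hsymm j o, hsymm j i]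
      ring
    · set s := ∑ i, x i with hs
      have h := hG (fun i => x i - if i = o then s else 0) (by simp [hs])
      have e : ∀ i j, (x i - if i = o then s else 0) * (G i j * (x j - if j = o then s else 0)) =
          x i * (G i j * x j) - (if i = o then s * (G o j * x j) else 0)
            - (if j = o then s * (G i o * x i) else 0)
            + (if i = o then if j = o then s * s * G o o else 0 else 0) := by
        intro i j
        split_ifs with h1 h2 h2 <;> simp_all <;> ring
      simp only [e, Finset.sum_add_distrib, Finset.sum_sub_distrib, Finset.sum_ite_eq',
        Finset.mem_univ, if_true] at h
      have h1 : ∑ i, ∑ j, (if i = o then s * (G o j * x j) else 0) = s * ∑ j, G o j * x j := by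
        rw [Finset.sum_comm]
        simp [Finset.mul_sum]
      have h2 : ∑ i, ∑ j, (if i = o then if j = o then s * s * G o o else 0 else 0) =
          s * s * G o o := by
        rw [Finset.sum_comm]
        simp
      have h3 : ∑ i, s * (G i o * x i) = s * ∑ j, G o j * x j := by
        rw [Finset.mul_sum]
        exact Finset.sum_congr rfl fun i _ => by rw [hsymm]
      have e' : ∀ i j, x i * ((G i o + G o j - G i j - G o o) * x j) =
          (G o i * x i) * x j + x i * (G o j * x j) - x i * (G i j * x j)
            - G o o * (x i * x j) := by
        intro i j
        rw [hsymm i o]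
        ring
      have h4 : ∑ j, G o j * x j = ∑ j, x j * G o j :=
        Finset.sum_congr rfl fun j _ => mul_comm _ _
      simp only [of_apply, e', Finset.sum_add_distrib, Finset.sum_sub_distrib,
        ← Finset.mul_sum, ← Finset.sum_mul, ← hs]
      simp only [h1, h2, h3, ← Finset.mul_sum] at h
      linarith
  have e : ∀ i j, -G i j = (-G i o + G o o / 2) + (-G j o + G o o / 2) +
      (G i o + G o j - G i j - G o o) := by
    intro i j
    rw [hsymm j o]
    ring
  have e' : ∀ i j, Real.exp (-G i j) = Real.exp (-G i o + G o o / 2) *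
      Real.exp (-G j o + G o o / 2) * Real.exp (G i o + G o j - G i j - G o o) := by
    intro i j
    rw [← Real.exp_add, ← Real.exp_add, ← e]
  simp only [e']
  exact (posSemidef_of_mul_self fun i => Real.exp (-G i o + G o o / 2)).of_mul hK.of_exp

theorem posSemidef_of_cos_sub (φ : ι → ℝ) :
    (Matrix.of fun i j => Real.cos (φ i - φ j)).PosSemidef := by
  simp only [Real.cos_sub]
  exact (posSemidef_of_mul_self fun i => Real.cos (φ i)).add
    (posSemidef_of_mul_self fun i => Real.sin (φ i))

theorem posSemidef_of_integral {α : Type*} [MeasurableSpace α] {μ : Measure α}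
    {M : α → Matrix ι ι ℝ} (hint : ∀ i j, Integrable (fun t => M t i j) μ)
    (hM : ∀ᵐ t ∂μ, (M t).PosSemidef) :
    (Matrix.of fun i j => ∫ t, M t i j ∂μ).PosSemidef := by
  refine posSemidef_iff_sum_mul_nonneg.2 ⟨fun i j => ?_, fun x => ?_⟩
  · refine integral_congr_ae ?_
    filter_upwards [hM] with t ht
    exact (posSemidef_iff_sum_mul_nonneg.1 ht).1 i j
  · have : ∑ i, ∑ j, x i * ((∫ t, M t i j ∂μ) * x j) =
        ∫ t, ∑ i, ∑ j, x i * (M t i j * x j) ∂μ := by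
      rw [integral_finsetSum _ fun i _ => integrable_finsetSum _ fun j _ =>
        ((hint i j).mul_const _).const_mul _]
      refine Finset.sum_congr rfl fun i _ => ?_
      rw [integral_finsetSum _ fun j _ => ((hint i j).mul_const _).const_mul _]
      refine Finset.sum_congr rfl fun j _ => ?_
      rw [integral_const_mul, integral_mul_const]
    simp only [of_apply]
    rw [this]
    refine integral_nonneg_of_ae ?_
    filter_upwards [hM] with t ht
    exact (posSemidef_iff_sum_mul_nonneg.1 ht).2 x

end FiniteKernels

section Gaussian

variable {κ : Type*} [Fintype κ]

theorem re_cexp_neg_half_mul_sum_add (c s : κ → ℝ) :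
    (Complex.exp (-(1 / 2 : ℂ) * ∑ i, (s i : ℂ) ^ 2 + ∑ i, (c i * Complex.I) * s i)).re =
      Real.exp (-(1 / 2) * (s ⬝ᵥ s)) * Real.cos (c ⬝ᵥ s) := by
  have : -(1 / 2 : ℂ) * ∑ i, (s i : ℂ) ^ 2 + ∑ i, (c i * Complex.I) * s i =
      ((-(1 / 2) * (s ⬝ᵥ s) : ℝ) : ℂ) + ((c ⬝ᵥ s : ℝ) : ℂ) * Complex.I := by
    simp only [dotProduct]
    push_cast
    rw [Finset.sum_mul]
    congr 1
    · simp [sq]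
    · exact Finset.sum_congr rfl fun i _ => by ring
  rw [this, Complex.exp_re]
  simp

theorem integrable_exp_neg_half_dotProduct_mul_cos (c : κ → ℝ) :
    Integrable fun s : κ → ℝ => Real.exp (-(1 / 2) * (s ⬝ᵥ s)) * Real.cos (c ⬝ᵥ s) := by
  have h := (GaussianFourier.integrable_cexp_neg_mul_sum_add (b := 1 / 2) (by norm_num)
    (fun i : κ => (c i : ℂ) * Complex.I)).re
  simpa only [RCLike.re_to_complex, re_cexp_neg_half_mul_sum_add] using h

theorem integral_exp_neg_half_dotProduct_mul_cos (c : κ → ℝ) :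
    ∫ s : κ → ℝ, Real.exp (-(1 / 2) * (s ⬝ᵥ s)) * Real.cos (c ⬝ᵥ s) =
      (2 * π) ^ (Fintype.card κ / 2 : ℝ) * Real.exp (-(1 / 2) * (c ⬝ᵥ c)) := by
  have hi := GaussianFourier.integrable_cexp_neg_mul_sum_add (b := 1 / 2) (by norm_num)
    (fun i : κ => (c i : ℂ) * Complex.I)
  have h := GaussianFourier.integral_cexp_neg_mul_sum_add (b := 1 / 2) (by norm_num)
    (fun i : κ => (c i : ℂ) * Complex.I)
  have hre := integral_re hi
  simp only [RCLike.re_to_complex, re_cexp_neg_half_mul_sum_add] at hre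
  rw [hre, h]
  have hr : (π / (1 / 2 : ℂ)) ^ (Fintype.card κ / 2 : ℂ) *
      Complex.exp ((∑ i, ((c i : ℂ) * Complex.I) ^ 2) / (4 * (1 / 2))) =
      (((2 * π) ^ (Fintype.card κ / 2 : ℝ) * Real.exp (-(1 / 2) * (c ⬝ᵥ c)) : ℝ) : ℂ) := by
    rw [Complex.ofReal_mul, Complex.ofReal_cpow (by positivity), Complex.ofReal_exp]
    congr 2
    · push_cast
      ring
    · push_cast
      rfl
    · simp only [mul_pow, Complex.I_sq, dotProduct]
      push_cast
      rw [← Finset.sum_mul]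
      simp only [sq]
      ring
  rw [hr, Complex.ofReal_re]

theorem continuous_exp_mul_cos (c : κ → ℝ) :
    Continuous fun s : κ → ℝ => Real.exp (-(1 / 2) * (s ⬝ᵥ s)) * Real.cos (c ⬝ᵥ s) := by
  simp only [dotProduct]
  fun_prop

variable [DecidableEq κ]

open scoped MatrixOrder Matrix.Norms.L2Operator in
theorem Matrix.PosDef.exists_eq_transpose_mul_self {A : Matrix κ κ ℝ} (hA : A.PosDef) :
    ∃ B : Matrix κ κ ℝ, B.det ≠ 0 ∧ A = Bᵀ * B := by
  obtain ⟨B, hB, h⟩ := CStarAlgebra.isStrictlyPositive_iff_eq_star_mul_self.1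
    hA.isStrictlyPositive
  exact ⟨B, ((isUnit_iff_isUnit_det B).1 hB).ne_zero, by simpa [star_eq_conjTranspose] using h⟩

theorem exp_mul_cos_comp_toLin' {B : Matrix κ κ ℝ} (hB : B.det ≠ 0) (w : κ → ℝ) :
    (fun t : κ → ℝ => Real.exp (-(1 / 2) * (t ⬝ᵥ (Bᵀ * B) *ᵥ t)) * Real.cos (w ⬝ᵥ t)) =
      (fun s => Real.exp (-(1 / 2) * (s ⬝ᵥ s)) * Real.cos ((w ᵥ* B⁻¹) ⬝ᵥ s)) ∘ toLin' B := by
  ext t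
  have h : B⁻¹ * B = 1 := nonsing_inv_mul B hB.isUnit
  simp only [Function.comp, toLin'_apply, ← dotProduct_mulVec, mulVec_mulVec, h, one_mulVec]
  rw [← mulVec_mulVec, dotProduct_mulVec t, vecMul_transpose]

theorem integrable_exp_neg_half_mulVec_mul_cos {A : Matrix κ κ ℝ} (hA : A.PosDef)
    (w : κ → ℝ) :
    Integrable fun t : κ → ℝ =>
      Real.exp (-(1 / 2) * (t ⬝ᵥ A *ᵥ t)) * Real.cos (w ⬝ᵥ t) := by
  obtain ⟨B, hB, rfl⟩ := hA.exists_eq_transpose_mul_self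
  rw [exp_mul_cos_comp_toLin' hB, ← integrable_map_measure
    (continuous_exp_mul_cos _).aestronglyMeasurable
    (toLin' B).continuous_of_finiteDimensional.aemeasurable,
    Real.map_matrix_volume_pi_eq_smul_volume_pi hB]
  exact (integrable_exp_neg_half_dotProduct_mul_cos _).smul_measure ENNReal.ofReal_ne_top

theorem integral_exp_neg_half_mulVec_mul_cos {A : Matrix κ κ ℝ} (hA : A.PosDef)
    (w : κ → ℝ) :
    ∫ t : κ → ℝ, Real.exp (-(1 / 2) * (t ⬝ᵥ A *ᵥ t)) * Real.cos (w ⬝ᵥ t) =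
      (2 * π) ^ (Fintype.card κ / 2 : ℝ) *
        (A.det ^ (-(1 : ℝ) / 2) * Real.exp (-(1 / 2) * (w ⬝ᵥ A⁻¹ *ᵥ w))) := by
  obtain ⟨B, hB, rfl⟩ := hA.exists_eq_transpose_mul_self
  have hdet : (Bᵀ * B).det ^ (-(1 : ℝ) / 2) = |B.det⁻¹| := by
    rw [det_mul, det_transpose, neg_div, Real.rpow_neg (mul_self_nonneg _),
      ← Real.sqrt_eq_rpow, Real.sqrt_mul_self_eq_abs, abs_inv]
  have hinv : w ⬝ᵥ (Bᵀ * B)⁻¹ *ᵥ w = (w ᵥ* B⁻¹) ⬝ᵥ (w ᵥ* B⁻¹) := by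
    rw [Matrix.mul_inv_rev, ← mulVec_mulVec, dotProduct_mulVec, ← transpose_nonsing_inv,
      mulVec_transpose]
  have hmap := integral_map (μ := volume)
    (toLin' B).continuous_of_finiteDimensional.aemeasurable
    (continuous_exp_mul_cos (w ᵥ* B⁻¹)).aestronglyMeasurable
  rw [exp_mul_cos_comp_toLin' hB]
  refine hmap.symm.trans ?_
  rw [ Real.map_matrix_volume_pi_eq_smul_volume_pi hB, integral_smul_measure,
    integral_exp_neg_half_dotProduct_mul_cos, hdet, hinv, ENNReal.toReal_ofReal (abs_nonneg _),
    smul_eq_mul]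
  ring

/-- If all the quadratic forms `t ↦ tᵀ A(x, y) t` are conditionally negative definite in `(x, y)`,
then the Gaussian kernel with covariance `A(x, y)` is positive semidefinite. -/
theorem posSemidef_gaussian_kernel {ι : Type*} [Fintype ι] {A : ι → ι → Matrix κ κ ℝ}
    (hA : ∀ x y, (A x y).PosDef) (hsymm : ∀ x y, A x y = A y x)
    (hneg : ∀ (t : κ → ℝ) (b : ι → ℝ), ∑ x, b x = 0 →
      ∑ x, ∑ y, b x * ((t ⬝ᵥ A x y *ᵥ t) * b y) ≤ 0)
    (v : ι → κ → ℝ) :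
    (Matrix.of fun x y => (A x y).det ^ (-(1 : ℝ) / 2) *
      Real.exp (-(1 / 2) * ((v x - v y) ⬝ᵥ (A x y)⁻¹ *ᵥ (v x - v y)))).PosSemidef := by
  have hexp : ∀ t : κ → ℝ,
      (Matrix.of fun x y => Real.exp (-(1 / 2) * (t ⬝ᵥ A x y *ᵥ t))).PosSemidef := by
    intro t
    simp only [neg_mul]
    refine posSemidef_exp_neg_of_condNegDef_s10 (fun x y => by rw [hsymm]) fun b hb => ?_
    have h := hneg t b hb
    have e : ∑ x, ∑ y, b x * (1 / 2 * (t ⬝ᵥ A x y *ᵥ t) * b y) =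
        1 / 2 * ∑ x, ∑ y, b x * ((t ⬝ᵥ A x y *ᵥ t) * b y) := by
      rw [Finset.mul_sum]
      refine Finset.sum_congr rfl fun x _ => ?_
      rw [Finset.mul_sum]
      exact Finset.sum_congr rfl fun y _ => by ring
    rw [e]
    linarith
  have hcos : ∀ t : κ → ℝ,
      (Matrix.of fun x y => Real.cos ((v x - v y) ⬝ᵥ t)).PosSemidef := by
    intro t
    simp only [sub_dotProduct]
    exact posSemidef_of_cos_sub fun x => v x ⬝ᵥ t
  have h := posSemidef_of_integral (μ := volume)
    (fun x y => integrable_exp_neg_half_mulVec_mul_cos (hA x y) (v x - v y))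
    (.of_forall fun t => (hexp t).of_mul (hcos t))
  simp only [integral_exp_neg_half_mulVec_mul_cos (hA _ _)] at h
  have hc : 0 < (2 * π) ^ (Fintype.card κ / 2 : ℝ) := by positivity
  have h' := h.smul (inv_nonneg.2 hc.le)
  convert h' using 1
  ext x y
  simp [inv_mul_cancel_left₀ hc.ne']

end Gaussian

theorem sum_dotProduct_mulVec_eq_sum_prod_s10 {m N : ℕ} {X : Type*}
    (C : X → X → Matrix (Fin m) (Fin m) ℝ) (x : Fin N → X) (a : Fin N → Fin m → ℝ) :
    ∑ p, ∑ q, a p ⬝ᵥ (C (x p) (x q)).mulVec (a q) =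
      ∑ y : Fin N × Fin m, ∑ z : Fin N × Fin m,
        a y.1 y.2 * (C (x y.1) (x z.1) y.2 z.2 * a z.1 z.2) := by
  simp only [Fintype.sum_prod_type, dotProduct, mulVec, Finset.mul_sum]
  exact Finset.sum_congr rfl fun p _ => Finset.sum_comm

theorem isPosDefKernel_of_posSemidef {m : ℕ} {X : Type*} {C : X → X → Matrix (Fin m) (Fin m) ℝ}
    (hsymm : ∀ x y i j, C x y i j = C y x j i)
    (h : ∀ (N : ℕ) (x : Fin N → X), (Matrix.of fun y z : Fin N × Fin m =>
      C (x y.1) (x z.1) y.2 z.2).PosSemidef) :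
    IsPosDefKernel C := by
  refine ⟨hsymm, fun N x a => ?_⟩
  rw [sum_dotProduct_mulVec_eq_sum_prod_s10]
  exact (posSemidef_iff_sum_mul_nonneg.1 (h N x)).2 fun y => a y.1 y.2

theorem IsCondNegDefKernel.sum_mul_nonpos {m N : ℕ} {X : Type*}
    {Γ : X → X → Matrix (Fin m) (Fin m) ℝ} (hΓ : IsCondNegDefKernel Γ) (x : Fin N → X)
    (b : Fin N × Fin m → ℝ) (hb : ∑ y, b y = 0) :
    ∑ y, ∑ z, b y * (Γ (x y.1) (x z.1) y.2 z.2 * b z) ≤ 0 := by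
  have h := hΓ.2 N x (fun p i => b (p, i)) (by simpa [Fintype.sum_prod_type] using hb)
  rwa [sum_dotProduct_mulVec_eq_sum_prod_s10] at h

/-- Lagrangian-type mixture. With `A_ij(u) = Σ + ∑_ℓ γ^ℓ_ij(u) Σ_ℓ` as in the
extended Gaussian model (for pseudo cross-variograms `γ^ℓ : ℝ → ℝ^{m×m}` with nonnegative
entries), `θ ∈ ℝ^d`, and integrable `f_ij : [0,∞) → ℝ` forming pointwise symmetric positive
semi-definite matrices, the function with entries
`C_ij(h,u) = det(A_ij(u))^{−1/2} ∫_0^∞ exp(−ω (1/2)(h+θu)ᵀ A_ij(u)⁻¹ (h+θu)) f_ij(ω) dω`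
is a positive definite matrix-valued function on `ℝ^d × ℝ`. -/
theorem lagrangian_mixture_posdef {d m n : ℕ}
    (γ : Fin n → ℝ → Matrix (Fin m) (Fin m) ℝ)
    (hγ : ∀ ℓ, IsPseudoCrossVariogram (γ ℓ))
    (hnn : ∀ ℓ u i j, 0 ≤ γ ℓ u i j)
    (S0 : Matrix (Fin d) (Fin d) ℝ) (hS0 : S0.PosDef)
    (S : Fin n → Matrix (Fin d) (Fin d) ℝ) (hS : ∀ ℓ, (S ℓ).PosSemidef)
    (A : Fin m → Fin m → ℝ → Matrix (Fin d) (Fin d) ℝ)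
    (hA : ∀ i j u, A i j u = S0 + ∑ ℓ, γ ℓ u i j • S ℓ)
    (θ : Fin d → ℝ)
    (f : Fin m → Fin m → ℝ → ℝ)
    (hint : ∀ i j, IntegrableOn (f i j) (Ici 0))
    (hsymm : ∀ ω, 0 ≤ ω → ∀ i j, f i j ω = f j i ω)
    (hpsd : ∀ ω, 0 ≤ ω → (Matrix.of fun i j => f i j ω).PosSemidef) :
    IsPosDefFun (fun hu : (Fin d → ℝ) × ℝ => Matrix.of fun i j =>
      (A i j hu.2).det ^ (-(1:ℝ)/2) *
        ∫ ω in Ioi (0:ℝ),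
          Real.exp (-ω * ((1/2) *
            ((hu.1 + hu.2 • θ) ⬝ᵥ (A i j hu.2)⁻¹.mulVec (hu.1 + hu.2 • θ)))) * f i j ω) := by
  have hApd : ∀ i j u, (A i j u).PosDef := fun i j u => by
    rw [hA]
    exact hS0.add_posSemidef (posSemidef_sum _ fun ℓ _ => (hS ℓ).smul (hnn ℓ u i j))
  have hAsymm : ∀ i j u, A i j (-u) = A j i u := fun i j u => by
    rw [hA, hA]
    congr 1
    refine Finset.sum_congr rfl fun ℓ _ => ?_
    have h := (hγ ℓ).1.1 0 u i j
    simp only [zero_sub, sub_zero] at h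
    rw [h]
  have hAsub : ∀ i j u u', A i j (u - u') = A j i (u' - u) := fun i j u u' => by
    rw [← hAsymm, neg_sub]
  have hquad : ∀ i j u (t : Fin d → ℝ),
      t ⬝ᵥ A i j u *ᵥ t = t ⬝ᵥ S0 *ᵥ t + ∑ ℓ, γ ℓ u i j * (t ⬝ᵥ S ℓ *ᵥ t) := fun i j u t => by
    rw [hA, add_mulVec, dotProduct_add, sum_mulVec, dotProduct_sum]
    simp [smul_mulVec, dotProduct_smul]
  refine isPosDefKernel_of_posSemidef (fun x y i j => ?_) fun N x => ?_
  · have hv : (x - y).1 + (x - y).2 • θ = -((y - x).1 + (y - x).2 • θ) := by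
      rw [← neg_sub y x, Prod.fst_neg, Prod.snd_neg, neg_smul, neg_add]
    have hAxy : A i j (x - y).2 = A j i (y - x).2 := hAsub i j x.2 y.2
    simp only [of_apply]
    rw [hv, hAxy, mulVec_neg, dotProduct_neg, neg_dotProduct, neg_neg]
    congr 1
    refine setIntegral_congr_fun measurableSet_Ioi fun ω hω => ?_
    simp only [hsymm ω (le_of_lt hω) i j]
  · let v : Fin N × Fin m → Fin d → ℝ := fun y => (x y.1).1 + (x y.1).2 • θ
    let B : Fin N × Fin m → Fin N × Fin m → Matrix (Fin d) (Fin d) ℝ :=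
      fun y z => A y.2 z.2 ((x y.1).2 - (x z.1).2)
    have hv : ∀ y z : Fin N × Fin m,
        (x y.1 - x z.1).1 + (x y.1 - x z.1).2 • θ = v y - v z := fun y z => by
      simp only [v, Prod.fst_sub, Prod.snd_sub, sub_smul]
      abel
    have hneg : ∀ (t : Fin d → ℝ) (b : Fin N × Fin m → ℝ), ∑ y, b y = 0 →
        ∑ y, ∑ z, b y * ((t ⬝ᵥ B y z *ᵥ t) * b z) ≤ 0 := by
      intro t b hb
      have e : ∀ y z, b y * ((t ⬝ᵥ B y z *ᵥ t) * b z) =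
          (t ⬝ᵥ S0 *ᵥ t) * (b y * b z) + ∑ ℓ, (t ⬝ᵥ S ℓ *ᵥ t) *
            (b y * (γ ℓ ((x y.1).2 - (x z.1).2) y.2 z.2 * b z)) := fun y z => by
        simp only [B, hquad, add_mul, mul_add, Finset.sum_mul, Finset.mul_sum]
        congr 1
        · ring
        · exact Finset.sum_congr rfl fun ℓ _ => by ring
      simp only [e, Finset.sum_add_distrib, ← Finset.mul_sum, hb, mul_zero, zero_add]
      rw [Finset.sum_congr rfl fun y _ => Finset.sum_comm, Finset.sum_comm]
      refine Finset.sum_nonpos fun ℓ _ => ?_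
      rw [Finset.sum_congr rfl fun y _ => (Finset.mul_sum ..).symm, ← Finset.mul_sum]
      refine mul_nonpos_of_nonneg_of_nonpos ?_
        ((hγ ℓ).1.sum_mul_nonpos (fun p => (x p).2) b hb)
      simpa using (hS ℓ).dotProduct_mulVec_nonneg t
    let q : Fin N × Fin m → Fin N × Fin m → ℝ := fun y z =>
      (v y - v z) ⬝ᵥ (B y z)⁻¹ *ᵥ (v y - v z)
    have hq : ∀ y z, 0 ≤ q y z := fun y z =>
      (hApd y.2 z.2 ((x y.1).2 - (x z.1).2)).inv.posSemidef.dotProduct_mulVec_nonneg (v y - v z)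
    have hker : ∀ ω ∈ Ioi (0 : ℝ), (Matrix.of fun y z => (B y z).det ^ (-(1 : ℝ) / 2) *
        (Real.exp (-ω * (1 / 2 * q y z)) * f y.2 z.2 ω)).PosSemidef := by
      intro ω hω
      have h := posSemidef_gaussian_kernel (A := B) (fun y z => hApd _ _ _)
        (fun y z => hAsub _ _ _ _) hneg (fun y => √ω • v y)
      have e : ∀ y z, -(1 / 2) * ((√ω • v y - √ω • v z) ⬝ᵥ
          (B y z)⁻¹ *ᵥ (√ω • v y - √ω • v z)) = -ω * (1 / 2 * q y z) := fun y z => by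
        rw [← smul_sub, mulVec_smul, smul_dotProduct, dotProduct_smul, smul_smul,
          Real.mul_self_sqrt (le_of_lt hω), smul_eq_mul]
        simp only [q]
        ring
      simp only [e] at h
      simp only [← mul_assoc (_ ^ (_ : ℝ))]
      exact h.of_mul ((hpsd ω (le_of_lt hω)).submatrix Prod.snd)
    have hfin := posSemidef_of_integral (μ := volume.restrict (Ioi 0)) (fun y z => ?_)
      ((ae_restrict_iff' measurableSet_Ioi).2 (.of_forall hker))
    · simp only [of_apply, integral_const_mul] at hfin
      simp only [of_apply, hv]
      exact hfin
    · simp only [of_apply]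
      refine Integrable.const_mul ?_ _
      refine ((hint y.2 z.2).mono_set Ioi_subset_Ici_self).bdd_mul (c := 1)
        (by fun_prop) ?_
      filter_upwards [ae_restrict_mem measurableSet_Ioi] with ω hω
      rw [Real.norm_eq_abs, Real.abs_exp, Real.exp_le_one_iff]
      have : 0 ≤ ω * (1 / 2 * q y z) := mul_nonneg (le_of_lt hω) (by linarith [hq y z])
      linarith
end
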